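/- Let Λ be a semi-stable net of quadrics in a,b,c,d,e with basis (Q1,Q2,Q3). Suppose Λ lies on a smooth quartic del Pezzo surface, i.e. there exist linearly independent P1,P2 ∈ Λ such that at every point v ∈ ℂ⁵ ∖ {0} with P1(v)=P2(v)=0 the gradients ∇P1(v) and ∇P2(v) are linearly independent. Then the ideal (Q1,Q2,Q3) ⊆ ℂ[a,b,c,d,e] is a radical ideal (the curve defined by the net is reduced). -/

import Mathlib

open MvPolynomial

/-- The space of polynomials in the five variables `a,b,c,d,e` (indexed `0,…,4`). -/
abbrev Quin : Type := MvPolynomial (Fin 5) ℂ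

/-- `m` is (the exponent vector of) a quadratic monomial. -/
def QuadMon (m : Fin 5 →₀ ℕ) : Prop := (m.sum fun _ n => n) = 2

/-- A net of quadrics: a 3-dimensional space of quadratic forms. -/
def IsNet (Λ : Submodule ℂ Quin) : Prop :=
  Module.finrank ℂ Λ = 3 ∧ ∀ Q ∈ Λ, MvPolynomial.IsHomogeneous Q 2

/-- The `ρ`-weight of a monomial. -/
def wt (ρ : Fin 5 → ℤ) (m : Fin 5 →₀ ℕ) : ℤ := ∑ i, (m i : ℤ) * ρ i

/-- `Λ` is semistable with respect to the weight vector `ρ`: there are three distinct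
quadratic monomials with total `ρ`-weight `≥ 0` such that the corresponding coefficient
map `Λ → ℂ³` is bijective. -/
def SemistableWrt (Λ : Submodule ℂ Quin) (ρ : Fin 5 → ℤ) : Prop :=
  ∃ m1 m2 m3 : Fin 5 →₀ ℕ, m1 ≠ m2 ∧ m1 ≠ m3 ∧ m2 ≠ m3 ∧
    QuadMon m1 ∧ QuadMon m2 ∧ QuadMon m3 ∧
    0 ≤ wt ρ m1 + wt ρ m2 + wt ρ m3 ∧
    Function.Bijective (fun Q : Λ =>
      (![MvPolynomial.coeff m1 (Q : Quin), MvPolynomial.coeff m2 (Q : Quin),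
         MvPolynomial.coeff m3 (Q : Quin)] : Fin 3 → ℂ))

/-- The twelve distinguished weight vectors `ρ1,…,ρ12`. -/
def rho : Fin 12 → Fin 5 → ℤ :=
  ![![1,1,1,1,-4], ![2,2,2,-3,-3], ![3,3,-2,-2,-2], ![4,-1,-1,-1,-1],
    ![3,3,3,-2,-7], ![4,4,-1,-1,-6], ![9,4,-1,-6,-6], ![7,2,2,-3,-8],
    ![12,7,2,-8,-13], ![9,4,-1,-1,-11], ![14,4,-1,-6,-11], ![13,8,3,-7,-17]]

/-- A normalized weight vector: nonincreasing, sums to zero and not identically zero. -/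
def IsNormalized (ρ : Fin 5 → ℤ) : Prop :=
  (∀ i j : Fin 5, i ≤ j → ρ j ≤ ρ i) ∧ (∑ i, ρ i) = 0 ∧ ρ ≠ 0

/-- Linear substitution of variables by the matrix `g`, as a linear map on polynomials. -/
noncomputable def substMap (g : Matrix (Fin 5) (Fin 5) ℂ) : Quin →ₗ[ℂ] Quin :=
  (MvPolynomial.aeval fun i => ∑ j, MvPolynomial.C (g i j) * MvPolynomial.X j).toLinearMap

/-- Semistability of a net (Hilbert–Mumford criterion for `SL(5)`). -/
def Semistable (Λ : Submodule ℂ Quin) : Prop :=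
  ∀ (g : Matrix.GeneralLinearGroup (Fin 5) ℂ) (ρ : Fin 5 → ℤ), IsNormalized ρ →
    SemistableWrt (Submodule.map (substMap (g : Matrix (Fin 5) (Fin 5) ℂ)) Λ) ρ

/-- The symmetric matrix of a quadratic form. -/
noncomputable def quadMatrix (Q : Quin) : Matrix (Fin 5) (Fin 5) ℂ :=
  Matrix.of fun i j =>
    if i = j then MvPolynomial.coeff (Finsupp.single i 2) Q
    else (1/2) * MvPolynomial.coeff (Finsupp.single i 1 + Finsupp.single j 1) Q

/-- The discriminant quintic `det (x·A1 + y·A2 + z·A3)` of a net with basis `Q1,Q2,Q3`. -/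
noncomputable def netDisc (Q1 Q2 Q3 : Quin) : MvPolynomial (Fin 3) ℂ :=
  Matrix.det (Matrix.of fun i j : Fin 5 =>
    MvPolynomial.C (quadMatrix Q1 i j) * MvPolynomial.X 0 +
    MvPolynomial.C (quadMatrix Q2 i j) * MvPolynomial.X 1 +
    MvPolynomial.C (quadMatrix Q3 i j) * MvPolynomial.X 2)

/-- The net lies on a smooth quartic del Pezzo surface. -/
def OnSmoothDelPezzo (Λ : Submodule ℂ Quin) : Prop :=
  ∃ P1 P2 : Quin, P1 ∈ Λ ∧ P2 ∈ Λ ∧ LinearIndependent ℂ ![P1, P2] ∧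
    ∀ v : Fin 5 → ℂ, v ≠ 0 → MvPolynomial.eval v P1 = 0 → MvPolynomial.eval v P2 = 0 →
      LinearIndependent ℂ
        ![fun i => MvPolynomial.eval v (MvPolynomial.pderiv i P1),
          fun i => MvPolynomial.eval v (MvPolynomial.pderiv i P2)]

/-- A pencil of linear maps between spaces of equal positive dimension has a singular member. -/
theorem exists_pencil_kernel {V W : Type*} [AddCommGroup V] [Module ℂ V] [FiniteDimensional ℂ V]
    [Nontrivial V] [AddCommGroup W] [Module ℂ W] [FiniteDimensional ℂ W]
    (h : Module.finrank ℂ V = Module.finrank ℂ W) (f g : V →ₗ[ℂ] W) :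
    ∃ (s t : ℂ) (v : V), (s ≠ 0 ∨ t ≠ 0) ∧ v ≠ 0 ∧ s • f v + t • g v = 0 := by
  by_cases hf : Function.Injective f
  · let e : V ≃ₗ[ℂ] W := f.linearEquivOfInjective hf h
    obtain ⟨μ, hμ⟩ := Module.End.exists_eigenvalue (e.symm.toLinearMap ∘ₗ g)
    obtain ⟨v, hv⟩ := hμ.exists_hasEigenvector
    refine ⟨-μ, 1, v, Or.inr one_ne_zero, hv.2, ?_⟩
    have h1 : e.symm (g v) = μ • v := hv.apply_eq_smul
    have h2 : g v = μ • f v := by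
      have := congrArg e h1
      rw [e.apply_symm_apply, map_smul] at this
      exact this
    simp [h2]
  · rw [← LinearMap.ker_eq_bot, ← ne_eq, Submodule.ne_bot_iff] at hf
    obtain ⟨v, hv, hv0⟩ := hf
    exact ⟨1, 0, v, Or.inl one_ne_zero, hv0, by simp [LinearMap.mem_ker.1 hv]⟩

/-- Two symmetric bilinear forms without a common singular isotropic vector are simultaneously
diagonalizable. -/
theorem exists_basis_diagonalizing (n : ℕ) : ∀ {V : Type} [AddCommGroup V] [Module ℂ V]
    [FiniteDimensional ℂ V] (_ : Module.finrank ℂ V = n) (A B : V →ₗ[ℂ] V →ₗ[ℂ] ℂ)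
    (_ : ∀ v w, A v w = A w v) (_ : ∀ v w, B v w = B w v)
    (_ : ∀ v ≠ 0, A v v = 0 → B v v = 0 → ∀ s t : ℂ, s • A v + t • B v = 0 → s = 0 ∧ t = 0),
    ∃ b : Module.Basis (Fin n) ℂ V, ∀ i j, i ≠ j → A (b i) (b j) = 0 ∧ B (b i) (b j) = 0 := by
  induction n with
  | zero =>
    intro V _ _ _ hV A B _ _ _
    exact ⟨Module.finBasisOfFinrankEq ℂ V hV, fun i => i.elim0⟩
  | succ n ih =>
    intro V _ _ _ hV A B hA hB hs
    have : Nontrivial V := Module.nontrivial_of_finrank_pos (R := ℂ) (by omega)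
    obtain ⟨s, t, v, hst, hv, hk⟩ := exists_pencil_kernel
      (W := Module.Dual ℂ V) (Subspace.dual_finrank_eq).symm A B
    have hkv : s * A v v + t * B v v = 0 := by simpa using LinearMap.congr_fun hk v
    obtain ⟨C, l, m, hCv, hAl, hBm⟩ : ∃ (C : V →ₗ[ℂ] ℂ) (l m : ℂ), C v ≠ 0 ∧ A v = l • C ∧
        B v = m • C := by
      by_cases hAv : A v v = 0
      · have hBv : B v v ≠ 0 := by
          intro hBv
          have := hs v hv hAv hBv s t hk
          tauto
        have ht : t = 0 := by simpa [hAv, hBv] using hkv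
        subst ht
        have hs0 : s ≠ 0 := by tauto
        refine ⟨B v, 0, 1, hBv, ?_, by simp⟩
        simpa [hs0] using hk
      · have ht : t ≠ 0 := by
          rintro rfl
          simp [hAv] at hkv
          tauto
        refine ⟨A v, 1, -(t⁻¹ * s), hAv, by simp, ?_⟩
        have : t⁻¹ • (s • A v + t • B v) = 0 := by rw [hk, smul_zero]
        rw [smul_add, smul_smul, smul_smul, inv_mul_cancel₀ ht, one_smul] at this
        rw [neg_smul]
        exact (neg_eq_of_add_eq_zero_right this).symm
    set N := LinearMap.ker C with hN
    have hC0 : C ≠ 0 := by rintro rfl; simp at hCv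
    have hNr : Module.finrank ℂ N = n := by
      have := Module.Dual.finrank_ker_add_one_of_ne_zero (f := C) hC0
      rw [hV] at this
      exact Nat.succ_injective this
    have hdec : ∀ z : V, ∃ c : ℂ, z + c • v ∈ N := fun z =>
      ⟨-(C z / C v), by simp [hN, LinearMap.mem_ker]; field_simp; simp⟩
    have hAN : ∀ w ∈ N, A v w = 0 := fun w hw => by
      rw [hAl, LinearMap.smul_apply, LinearMap.mem_ker.1 hw, smul_zero]
    have hBN : ∀ w ∈ N, B v w = 0 := fun w hw => by
      rw [hBm, LinearMap.smul_apply, LinearMap.mem_ker.1 hw, smul_zero]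
    obtain ⟨b, hb⟩ := ih hNr (A.domRestrict₁₂ N N) (B.domRestrict₁₂ N N)
      (fun x y => hA x y) (fun x y => hB x y) (by
        intro w hw hAw hBw s t hst
        refine hs w (by simpa using hw) hAw hBw s t ?_
        ext z
        obtain ⟨c, hc⟩ := hdec z
        have h1 := LinearMap.congr_fun hst ⟨z + c • v, hc⟩
        have h2 := hAN w w.2
        have h3 := hBN w w.2
        rw [hA] at h2
        rw [hB] at h3
        change s * A w (z + c • v) + t * B w (z + c • v) = 0 at h1
        simpa [h2, h3] using h1)
    let b' : Module.Basis (Fin (n + 1)) ℂ V := Module.Basis.mkFinCons v b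
      (fun c x hx h => by
        have : C (c • v + x) = 0 := by rw [h, map_zero]
        rw [map_add, LinearMap.mem_ker.1 hx, map_smul] at this
        simpa [hCv] using this) hdec
    refine ⟨b', fun i j => ?_⟩
    refine Fin.cases ?_ (fun i => ?_) i <;> refine Fin.cases ?_ (fun j => ?_) j
    · simp
    · intro _
      simp only [b', Module.Basis.coe_mkFinCons, Fin.cons_zero, Fin.cons_succ, Function.comp]
      exact ⟨hAN _ (b j).2, hBN _ (b j).2⟩
    · intro _
      simp only [b', Module.Basis.coe_mkFinCons, Fin.cons_zero, Fin.cons_succ, Function.comp]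
      rw [hA, hB]
      exact ⟨hAN _ (b i).2, hBN _ (b i).2⟩
    · intro hij
      simp only [b', Module.Basis.coe_mkFinCons, Fin.cons_succ, Function.comp]
      exact hb i j (fun h => hij (by rw [h]))

open UniqueFactorizationMonoid in
theorem Squarefree.dvd_of_sq_dvd_sq_mul {T : Type*} [CommRing T] [IsDomain T]
    [UniqueFactorizationMonoid T] {u : T} (hu : Squarefree u) {m a : T} (hm : m ≠ 0)
    (h : m ^ 2 ∣ a ^ 2 * u) : m ∣ a := by
  obtain ⟨m', a', c, hrel, rfl, rfl⟩ := exists_reduced_factors m hm a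
  have hc : c ≠ 0 := left_ne_zero_of_mul hm
  rw [mul_pow, mul_pow, mul_assoc, mul_dvd_mul_iff_left (pow_ne_zero 2 hc)] at h
  have h2 : m' ^ 2 ∣ u := (IsRelPrime.pow hrel).dvd_of_dvd_mul_left h
  have h3 : IsUnit m' := hu m' (by rwa [← sq])
  exact mul_dvd_mul_left c h3.dvd

theorem Squarefree.eq_zero_of_sq_eq_mul_sq {T : Type*} [CommRing T] [IsDomain T]
    [UniqueFactorizationMonoid T] {u : T} (hu : Squarefree u) (hu' : ¬ IsUnit u) {a b : T}
    (h : a ^ 2 = u * b ^ 2) : b = 0 := by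
  by_contra hb
  obtain ⟨k, rfl⟩ := squarefree_one.dvd_of_sq_dvd_sq_mul hb (a := a)
    (by rw [mul_one, h]; exact dvd_mul_left _ _)
  have hk : k * k = u := by
    refine mul_left_cancel₀ (pow_ne_zero 2 hb) ?_
    linear_combination h
  exact hu' (hk ▸ (hu k hk.dvd).mul (hu k hk.dvd))

theorem dvd_of_isIntegral {D F : Type*} [CommRing D] [IsDomain D] [IsIntegrallyClosed D]
    [Field F] [Algebra D F] [FaithfulSMul D F] {m a : D} (hm : m ≠ 0) {y : F}
    (hy : algebraMap D F m * y = algebraMap D F a) (hi : IsIntegral D y) : m ∣ a := by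
  let φ : FractionRing D →ₐ[D] F :=
    IsFractionRing.liftAlgHom (g := Algebra.ofId D F) (FaithfulSMul.algebraMap_injective D F)
  have hmF : algebraMap D F m ≠ 0 := by
    simpa using hm
  have hmK : algebraMap D (FractionRing D) m ≠ 0 := by
    simpa using hm
  set z : FractionRing D := algebraMap D _ a / algebraMap D _ m with hz
  have hφ : φ z = y := by
    rw [hz, map_div₀, φ.commutes, φ.commutes, ← hy, mul_div_cancel_left₀ _ hmF]
  have hzi : IsIntegral D z := by
    rw [← hφ] at hi
    exact (isIntegral_algHom_iff φ φ.toRingHom.injective).1 hi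
  obtain ⟨c, hc⟩ := IsIntegrallyClosed.isIntegral_iff.1 hzi
  refine ⟨c, FaithfulSMul.algebraMap_injective D (FractionRing D) ?_⟩
  rw [map_mul, hc, hz, mul_div_cancel₀ _ hmK]

namespace QuadraticAlgebra

variable {D : Type*} [CommRing D] [IsDomain D] {w : D}

theorem isDomain_of_forall (h : ∀ a b : D, a ^ 2 = w * b ^ 2 → b = 0) :
    IsDomain (QuadraticAlgebra D w 0) := by
  have h0 : ∀ x : QuadraticAlgebra D w 0, x.re ^ 2 - w * x.im ^ 2 = 0 → x = 0 := by
    intro x hx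
    have him := h _ _ (sub_eq_zero.1 hx)
    rw [him] at hx
    ext
    · simpa using hx
    · exact him
  have : NoZeroDivisors (QuadraticAlgebra D w 0) := ⟨fun {x y} hxy => by
    have h1 := congrArg re hxy
    have h2 := congrArg im hxy
    simp only [re_mul, im_mul, re_zero, im_zero] at h1 h2
    have h3 : (x.re ^ 2 - w * x.im ^ 2) * (y.re ^ 2 - w * y.im ^ 2) = 0 := by
      linear_combination (x.re * y.re + w * x.im * y.im) * h1 -
        w * (x.re * y.im + x.im * y.re) * h2
    exact (mul_eq_zero.1 h3).imp (h0 x) (h0 y)⟩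
  exact NoZeroDivisors.to_isDomain _

omit [IsDomain D] in
theorem mul_star_eq (x : QuadraticAlgebra D w 0) :
    x * star x = algebraMap D _ (x.re ^ 2 - w * x.im ^ 2) := by
  ext <;> simp only [algebraMap_eq, re_mul, im_mul, re_star, im_star] <;> ring

theorem norm_ne_zero (h : ∀ a b : D, a ^ 2 = w * b ^ 2 → b = 0)
    {x : QuadraticAlgebra D w 0} (hx : x ≠ 0) : x.re ^ 2 - w * x.im ^ 2 ≠ 0 := by
  have := isDomain_of_forall h
  intro h0
  have := mul_star_eq x
  rw [h0, map_zero] at this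
  rcases mul_eq_zero.1 this with h1 | h1
  · exact hx h1
  · exact hx (by simpa using h1)

theorem isIntegrallyClosed_of_forall [IsIntegrallyClosed D] (h2 : IsUnit (2 : D))
    (h : ∀ a b : D, a ^ 2 = w * b ^ 2 → b = 0)
    (hsq : ∀ m a : D, m ≠ 0 → m ^ 2 ∣ a ^ 2 * w → m ∣ a) :
    IsIntegrallyClosed (QuadraticAlgebra D w 0) := by
  have := isDomain_of_forall h
  set F := FractionRing (QuadraticAlgebra D w 0)
  have hfaith : FaithfulSMul D (QuadraticAlgebra D w 0) :=
    (faithfulSMul_iff_algebraMap_injective D (QuadraticAlgebra D w 0)).2 algebraMap_injective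
  have hfaith' : FaithfulSMul D F := FaithfulSMul.trans D (QuadraticAlgebra D w 0) F
  rw [isIntegrallyClosed_iff F]
  intro x hx
  obtain ⟨n, d, hd, rfl⟩ := IsFractionRing.div_surjective (A := (QuadraticAlgebra D w 0)) x
  have hd0 : d ≠ 0 := nonZeroDivisors.ne_zero hd
  set m := d.re ^ 2 - w * d.im ^ 2
  have hm : m ≠ 0 := norm_ne_zero h hd0
  obtain ⟨a, b, hab⟩ : ∃ a b : D, n * star d = ⟨a, b⟩ := ⟨_, _, rfl⟩
  set x : F := algebraMap (QuadraticAlgebra D w 0) F n / algebraMap (QuadraticAlgebra D w 0) F d with hxdef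
  have hdF : algebraMap (QuadraticAlgebra D w 0) F d ≠ 0 := by simpa using hd0
  have hmx : algebraMap D F m * x = algebraMap (QuadraticAlgebra D w 0) F ⟨a, b⟩ := by
    rw [IsScalarTower.algebraMap_apply D (QuadraticAlgebra D w 0) F, ← mul_star_eq, ← hab, map_mul, map_mul, hxdef,
      mul_right_comm, mul_div_cancel₀ _ hdF]
  have hxD : IsIntegral D x := isIntegral_trans x hx
  let σ : F →+* F := IsFractionRing.map (A := (QuadraticAlgebra D w 0)) (B := (QuadraticAlgebra D w 0)) (K := F) (L := F)
    (j := starRingEnd (QuadraticAlgebra D w 0)) star_injective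
  have hσ : ∀ y : (QuadraticAlgebra D w 0), σ (algebraMap (QuadraticAlgebra D w 0) F y) = algebraMap (QuadraticAlgebra D w 0) F (star y) := fun y =>
    IsLocalization.map_eq _ y
  have hσD : ∀ y : D, σ (algebraMap D F y) = algebraMap D F y := fun y => by
    rw [IsScalarTower.algebraMap_apply D (QuadraticAlgebra D w 0) F, hσ]
    congr 1
    ext <;> simp [algebraMap_eq]
  have hxσ : IsIntegral D (σ x) :=
    hxD.map_of_comp_eq (RingHom.id D) σ (by ext y; simp [hσD])
  have hmσ : algebraMap D F m * σ x = algebraMap (QuadraticAlgebra D w 0) F ⟨a, -b⟩ := by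
    rw [← hσD m, ← map_mul, hmx, hσ]
    congr 1
    ext <;> simp
  have ha : m ∣ a := by
    have : m ∣ 2 * a := by
      refine dvd_of_isIntegral (F := F) hm (y := x + σ x) ?_ (hxD.add hxσ)
      rw [mul_add, hmx, hmσ, ← map_add, IsScalarTower.algebraMap_apply D (QuadraticAlgebra D w 0) F]
      congr 1
      ext <;> simp [algebraMap_eq]
      ring
    exact h2.dvd_mul_left.1 this
  have hb : m ∣ b := by
    have : m ^ 2 ∣ (2 * b) ^ 2 * w := by
      refine dvd_of_isIntegral (F := F) (pow_ne_zero 2 hm) (y := (x - σ x) ^ 2) ?_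
        ((hxD.sub hxσ).pow 2)
      rw [map_pow, ← mul_pow, mul_sub, hmx, hmσ, ← map_sub, ← map_pow,
        IsScalarTower.algebraMap_apply D (QuadraticAlgebra D w 0) F]
      congr 1
      ext <;> simp [algebraMap_eq, sq]
      ring
    exact h2.dvd_mul_left.1 (hsq _ _ hm this)
  obtain ⟨a', rfl⟩ := ha
  obtain ⟨b', rfl⟩ := hb
  refine ⟨⟨a', b'⟩, ?_⟩
  have hmF : algebraMap D F m ≠ 0 := by simpa using hm
  refine mul_left_cancel₀ hmF ?_
  rw [hmx, IsScalarTower.algebraMap_apply D (QuadraticAlgebra D w 0) F, ← map_mul]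
  congr 1
  ext <;> simp

theorem sq_dvd_tower {T : Type*} [CommRing T] [IsDomain T] [UniqueFactorizationMonoid T]
    {u w : T} (h2 : IsUnit (2 : T)) (hu : Squarefree u) (hu' : ¬ IsUnit u) (hw : Squarefree w)
    (huw : Squarefree (u * w))
    (m a : QuadraticAlgebra T u 0) (hm : m ≠ 0)
    (h : m ^ 2 ∣ a ^ 2 * algebraMap T _ w) : m ∣ a := by
  have hns : ∀ a b : T, a ^ 2 = u * b ^ 2 → b = 0 := fun a b => hu.eq_zero_of_sq_eq_mul_sq hu'
  have := isDomain_of_forall hns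
  have hms : star m ≠ 0 := by simpa using hm
  set n := m.re ^ 2 - u * m.im ^ 2 with hn
  have hn0 : n ≠ 0 := norm_ne_zero hns hm
  suffices h' : algebraMap T (QuadraticAlgebra T u 0) n ∣ a * star m by
    rw [hn, ← mul_star_eq] at h'
    exact (mul_dvd_mul_iff_right hms).1 h'
  have h3 : algebraMap T (QuadraticAlgebra T u 0) (n ^ 2) ∣ (a * star m) ^ 2 * algebraMap T _ w := by
    have := mul_dvd_mul_right h (star m ^ 2)
    rw [map_pow, hn, ← mul_star_eq, mul_pow, mul_pow]
    convert this using 1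
    ring
  set c := a * star m
  have hre : n ^ 2 ∣ (c.re ^ 2 + u * c.im ^ 2) * w := by
    obtain ⟨e, he⟩ := h3
    have := congrArg re he
    simp [sq] at this
    exact ⟨e.re, by linear_combination this⟩
  have him : n ^ 2 ∣ 2 * c.re * c.im * w := by
    obtain ⟨e, he⟩ := h3
    have := congrArg im he
    simp [sq] at this
    exact ⟨e.im, by linear_combination this⟩
  have hN : n ^ 2 ∣ (c.re ^ 2 - u * c.im ^ 2) * w := by
    refine squarefree_one.dvd_of_sq_dvd_sq_mul (pow_ne_zero 2 hn0) ?_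
    obtain ⟨e, he⟩ := hre
    obtain ⟨f, hf⟩ := him
    refine ⟨e ^ 2 - u * f ^ 2, ?_⟩
    linear_combination ((c.re ^ 2 + u * c.im ^ 2) * w + n ^ 2 * e) * he
      - u * (2 * c.re * c.im * w + n ^ 2 * f) * hf
  have h0 : n ∣ c.re := by
    refine hw.dvd_of_sq_dvd_sq_mul hn0 (h2.dvd_mul_left.1 ?_)
    convert dvd_add hre hN using 1
    ring
  have h1 : n ∣ c.im := by
    refine huw.dvd_of_sq_dvd_sq_mul hn0 (h2.dvd_mul_left.1 ?_)
    convert dvd_sub hre hN using 1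
    ring
  obtain ⟨e, he⟩ := h0
  obtain ⟨f, hf⟩ := h1
  exact ⟨⟨e, f⟩, by ext <;> simp [he, hf]⟩

theorem eq_zero_of_sq_eq_tower {T : Type*} [CommRing T] [IsDomain T] [UniqueFactorizationMonoid T]
    {u w : T} (h2 : (2 : T) ≠ 0) (hu : Squarefree u) (hu' : ¬ IsUnit u) (hw : Squarefree w)
    (hw' : ¬ IsUnit w) (huw : Squarefree (u * w))
    (a b : QuadraticAlgebra T u 0) (h : a ^ 2 = algebraMap T _ w * b ^ 2) : b = 0 := by
  have hns : ∀ a b : T, a ^ 2 = u * b ^ 2 → b = 0 := fun a b => hu.eq_zero_of_sq_eq_mul_sq hu'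
  have := isDomain_of_forall hns
  by_contra hb
  set n := b.re ^ 2 - u * b.im ^ 2 with hn
  have hn0 : n ≠ 0 := norm_ne_zero hns hb
  have h3 : (a * star b) ^ 2 = algebraMap T (QuadraticAlgebra T u 0) (w * n ^ 2) := by
    rw [map_mul, map_pow, hn, ← mul_star_eq, mul_pow, mul_pow, h]
    ring
  set c := a * star b
  have hre := congrArg re h3
  have him := congrArg im h3
  simp [sq] at hre him
  have : c.re = 0 ∨ c.im = 0 := by
    have : 2 * (c.re * c.im) = 0 := by linear_combination him
    simpa [h2] using this
  rcases this with h0 | h0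
  · refine hn0 (huw.eq_zero_of_sq_eq_mul_sq (fun h => hu' (isUnit_of_mul_isUnit_left h))
      (a := u * c.im) ?_)
    rw [h0] at hre
    linear_combination u * hre
  · refine hn0 (hw.eq_zero_of_sq_eq_mul_sq hw' (a := c.re) ?_)
    rw [h0] at hre
    linear_combination hre

end QuadraticAlgebra

/-- The linear form with the given coefficients. -/
noncomputable def linForm {n : ℕ} : (Fin n → ℂ) →ₗ[ℂ] MvPolynomial (Fin n) ℂ :=
  Fintype.linearCombination ℂ X

theorem linForm_apply {n : ℕ} (v : Fin n → ℂ) : linForm v = ∑ i, v i • X i := rfl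

theorem coeff_linForm {n : ℕ} (v : Fin n → ℂ) (i : Fin n) :
    coeff (Finsupp.single i 1) (linForm v) = v i := by
  simp [linForm_apply, coeff_sum, coeff_X, Finsupp.single_left_inj]

theorem linForm_injective {n : ℕ} : Function.Injective (linForm (n := n)) := fun v w h => by
  ext i
  rw [← coeff_linForm v, h, coeff_linForm]

theorem isHomogeneous_linForm {n : ℕ} (v : Fin n → ℂ) : (linForm v).IsHomogeneous 1 := by
  rw [linForm_apply]
  refine IsHomogeneous.sum _ _ _ fun i _ => ?_
  rw [smul_eq_C_mul]
  simpa using (isHomogeneous_C (Fin n) (v i)).mul (isHomogeneous_X ℂ i)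

theorem isUnit_of_totalDegree_eq_zero {σ : Type*} {d : MvPolynomial σ ℂ} (hd : d ≠ 0)
    (h : d.totalDegree = 0) : IsUnit d := by
  rw [totalDegree_eq_zero_iff_eq_C] at h
  rw [h] at hd ⊢
  exact (IsUnit.mk0 _ (fun h0 => hd (by rw [h0, C_0]))).map C

theorem isRelPrime_linForm {n : ℕ} {v w : Fin n → ℂ} (h : LinearIndependent ℂ ![v, w]) :
    IsRelPrime (linForm v) (linForm w) := by
  have key : ∀ (d : MvPolynomial (Fin n) ℂ) (v : Fin n → ℂ), v ≠ 0 → d ∣ linForm v → ¬ IsUnit d →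
      ∃ c : ℂ, c ≠ 0 ∧ linForm v = c • d := by
    rintro d v hv ⟨e, he⟩ hd
    have hne : linForm v ≠ 0 := fun h0 => hv (linForm_injective (by rw [h0, map_zero]))
    have hd0 : d ≠ 0 := by rintro rfl; simp [he] at hne
    have he0 : e ≠ 0 := by rintro rfl; simp [he] at hne
    have hdeg := (isHomogeneous_linForm v).totalDegree hne
    rw [he, totalDegree_mul_of_isDomain hd0 he0] at hdeg
    have hd1 : d.totalDegree ≠ 0 := fun h => hd (isUnit_of_totalDegree_eq_zero hd0 h)
    have he1 : e.totalDegree = 0 := by omega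
    rw [totalDegree_eq_zero_iff_eq_C] at he1
    refine ⟨coeff 0 e, fun h0 => he0 (by rw [he1, h0, C_0]), ?_⟩
    rw [he, he1, smul_eq_C_mul, coeff_C, if_pos rfl, mul_comm]
  intro d hdv hdw
  by_contra hd
  rw [LinearIndependent.pair_iff] at h
  obtain ⟨c, hc, hcv⟩ := key d v (by rintro rfl; simpa using h 1 0) hdv hd
  obtain ⟨c', hc', hcw⟩ := key d w (by rintro rfl; simpa using h 0 1) hdw hd
  have := h c' (-c) (linForm_injective (by
    rw [map_add, map_smul, map_smul, hcv, hcw, map_zero, smul_smul, smul_smul, neg_mul,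
      mul_comm c', neg_smul, add_neg_cancel]))
  exact hc' this.1

/-- The diagonal quadratic form with the given coefficients. -/
noncomputable def diagForm {n : ℕ} (u : Fin n → ℂ) : MvPolynomial (Fin n) ℂ :=
  ∑ i, u i • X i ^ 2

theorem pderiv_diagForm {n : ℕ} (u : Fin n → ℂ) (i : Fin n) :
    pderiv i (diagForm u) = (2 * u i) • X i := by
  have h : ∀ j, pderiv i (u j • X j ^ 2 : MvPolynomial (Fin n) ℂ) =
      if j = i then (2 * u i) • X i else 0 := by
    intro j
    rw [Derivation.map_smul, pderiv_pow, pderiv_X]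
    split_ifs with hj
    · subst hj
      simp [smul_eq_C_mul, map_ofNat C 2]
      ring
    · simp [hj]
  rw [diagForm, map_sum, Finset.sum_congr rfl fun j _ => h j]
  simp

theorem not_isUnit_diagForm {n : ℕ} (u : Fin n → ℂ) : ¬ IsUnit (diagForm u) := fun h => by
  have := h.map (eval (0 : Fin n → ℂ))
  simp [diagForm] at this

theorem dvd_X_of_sq_dvd_diagForm {n : ℕ} {u : Fin n → ℂ} {i : Fin n} (hu : u i ≠ 0)
    {d : MvPolynomial (Fin n) ℂ} (h : d * d ∣ diagForm u) : d ∣ X i := by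
  have h1 : d ∣ pderiv i (diagForm u) := by
    obtain ⟨e, he⟩ := h
    rw [he, mul_assoc, Derivation.leibniz, smul_eq_mul, smul_eq_mul, Derivation.leibniz]
    simp only [smul_eq_mul]
    exact ⟨d * pderiv i e + e * pderiv i d + e * pderiv i d, by ring⟩
  rw [pderiv_diagForm] at h1
  have := h1.mul_left (C (2 * u i)⁻¹)
  rwa [smul_eq_C_mul, ← mul_assoc, ← C_mul, inv_mul_cancel₀ (by simpa using hu), C_1,
    one_mul] at this

theorem squarefree_diagForm {u : Fin 3 → ℂ} (hu : ∀ i, u i ≠ 0) : Squarefree (diagForm u) := by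
  intro d hd
  have h0 : d ∣ linForm (Pi.single 0 1) := by
    simpa [linForm_apply, Pi.single_apply] using dvd_X_of_sq_dvd_diagForm (hu 0) hd
  have h1 : d ∣ linForm (Pi.single 1 1) := by
    simpa [linForm_apply, Pi.single_apply] using dvd_X_of_sq_dvd_diagForm (hu 1) hd
  refine isRelPrime_linForm (LinearIndependent.pair_iff.2 fun s t hst => ⟨?_, ?_⟩) h0 h1
  · simpa using congrFun hst 0
  · simpa using congrFun hst 1

theorem isRelPrime_diagForm {u w : Fin 3 → ℂ}
    (h : ∀ i j, i ≠ j → u i * w j - u j * w i ≠ 0) : IsRelPrime (diagForm u) (diagForm w) := by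
  intro d hdu hdw
  have hd0 : d ≠ 0 := by
    rintro rfl
    have h1 := zero_dvd_iff.1 hdu
    have h2 := zero_dvd_iff.1 hdw
    have h3 := congrArg (eval (Pi.single 0 1)) h1
    have h4 := congrArg (eval (Pi.single 0 1)) h2
    simp [diagForm, Pi.single_apply] at h3 h4
    exact h 0 1 (by decide) (by rw [h3, h4]; ring)
  have hdeg : ∀ i, degreeOf i d = 0 := by
    intro i
    have hdvd : d ∣ C (w i) * diagForm u - C (u i) * diagForm w :=
      dvd_sub (hdu.mul_left _) (hdw.mul_left _)
    have hf : C (w i) * diagForm u - C (u i) * diagForm w =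
        diagForm (fun j => w i * u j - u i * w j) := by
      simp only [diagForm, Finset.mul_sum, ← Finset.sum_sub_distrib, smul_eq_C_mul, C_sub, C_mul]
      exact Finset.sum_congr rfl fun j _ => by ring
    rw [hf] at hdvd
    obtain ⟨e, he⟩ := hdvd
    have hne : diagForm (fun j => w i * u j - u i * w j) ≠ 0 := by
      intro h0
      obtain ⟨j, hj⟩ := exists_ne i
      have := congrArg (eval (Pi.single j 1)) h0
      simp [diagForm, Pi.single_apply] at this
      exact h i j hj.symm (by linear_combination -this)
    have hdegf : degreeOf i (diagForm (fun j => w i * u j - u i * w j)) = 0 := by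
      refine Nat.le_zero.1 ((degreeOf_sum_le _ _ _).trans (Finset.sup_le fun j _ => ?_))
      by_cases hj : j = i
      · subst hj
        simp [mul_comm]
      · rw [smul_eq_C_mul]
        refine (degreeOf_C_mul_le _ _ _).trans ((degreeOf_pow_le _ _ _).trans ?_)
        rw [degreeOf_X_of_ne (Ne.symm hj), mul_zero]
    rw [he] at hne hdegf
    rw [degreeOf_mul_eq (left_ne_zero_of_mul hne) (right_ne_zero_of_mul hne)] at hdegf
    omega
  refine isUnit_of_totalDegree_eq_zero hd0 ?_
  rw [totalDegree_eq_zero_iff]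
  intro m hm x
  exact Nat.le_zero.1 ((monomial_le_degreeOf x hm).trans (hdeg x).le)
theorem exists_prime_colon {A : Type*} [CommRing A] [IsDomain A] [IsIntegrallyClosed A]
    [IsNoetherianRing A] {q : A} (hq : q ≠ 0) (hr : ¬ (Ideal.span {q}).IsRadical) :
    ∃ (f : A) (P : Ideal A), P.IsPrime ∧ (∀ y, y ∈ P ↔ q ∣ y * f) ∧ f ∈ P ∧
      ∃ h ∈ P, ∃ s, s ∉ P ∧ f * h = q * s := by
  rw [Ideal.isRadical_iff_pow_one_lt 2 one_lt_two] at hr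
  push Not at hr
  obtain ⟨f₀, hf₀, hf₀'⟩ := hr
  rw [Ideal.mem_span_singleton] at hf₀ hf₀'
  obtain ⟨col, hcol⟩ : ∃ col : A → Ideal A, ∀ x y, y ∈ col x ↔ q ∣ y * x :=
    ⟨fun x => Submodule.comap (LinearMap.toSpanSingleton A A x) (Ideal.span {q}),
      fun x y => by simp [Ideal.mem_span_singleton]⟩
  obtain ⟨f, hf, hff, hmax⟩ : ∃ f, ¬ q ∣ f ∧ q ∣ f * f ∧ ∀ x, ¬ q ∣ x * f → ¬ col f < col (x * f) := by
    obtain ⟨P, ⟨g, hg, rfl⟩, hmax⟩ := set_has_maximal_iff_noetherian.2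
      (inferInstanceAs (IsNoetherian A A)) {K : Ideal A | ∃ g, ¬ q ∣ g * f₀ ∧ K = col (g * f₀)}
      ⟨_, 1, by rwa [one_mul], rfl⟩
    refine ⟨g * f₀, hg, ?_, fun x hx => hmax _ ⟨x * g, by rwa [mul_assoc], by rw [mul_assoc]⟩⟩
    convert hf₀.mul_left (g ^ 2) using 1
    ring
  have hprime : (col f).IsPrime := by
    refine ⟨fun h => hf ?_, fun {x y} hxy => ?_⟩
    · simpa [hcol] using (h ▸ Submodule.mem_top : (1 : A) ∈ col f)
    · by_contra! hcon
      rw [hcol] at hxy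
      refine hmax x (fun h => hcon.1 ((hcol _ _).2 h))
        (SetLike.lt_iff_le_and_exists.2 ⟨fun z hz => ?_, y, ?_, hcon.2⟩)
      · rw [hcol] at hz ⊢
        convert hz.mul_left x using 1
        ring
      · rw [hcol]
        convert hxy using 1
        ring
  refine ⟨f, col f, hprime, hcol f, (hcol f f).2 hff, ?_⟩
  by_contra! hcon
  refine hf ?_
  let F := FractionRing A
  have hqF : algebraMap A F q ≠ 0 := by simpa using hq
  have hintegral : IsIntegral A (algebraMap A F f / algebraMap A F q) := by
    refine isIntegral_of_smul_mem_submodule (Submodule.map (Algebra.linearMap A F) (col f)) ?_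
      (Submodule.FG.map _ (IsNoetherian.noetherian _)) _ ?_
    · rw [Submodule.ne_bot_iff]
      exact ⟨algebraMap A F q, ⟨q, (hcol f q).2 (dvd_mul_right _ _), rfl⟩, hqF⟩
    · rintro _ ⟨h, hh, rfl⟩
      obtain ⟨s, hs⟩ := (hcol f h).1 hh
      refine ⟨s, by_contra fun hsP => hcon h hh s hsP (by rw [mul_comm, hs]), ?_⟩
      have := congrArg (algebraMap A F) hs
      rw [map_mul, map_mul] at this
      simp only [Algebra.linearMap_apply, smul_eq_mul]
      rw [div_mul_eq_mul_div, eq_div_iff hqF]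
      linear_combination -this
  obtain ⟨c, hc⟩ := IsIntegrallyClosed.isIntegral_iff.1 hintegral
  refine ⟨c, FaithfulSMul.algebraMap_injective A F ?_⟩
  rw [map_mul, hc, mul_div_cancel₀ _ hqF]

/-- The coordinate ring of the intersection of the quadrics `X 3 ^ 2 = u` and `X 4 ^ 2 = w`, as
an iterated quadratic extension of the polynomial ring in three variables. -/
abbrev DelPezzoRing (u w : Fin 3 → ℂ) : Type :=
  QuadraticAlgebra (QuadraticAlgebra (MvPolynomial (Fin 3) ℂ) (diagForm u) 0)
    (algebraMap _ _ (diagForm w)) 0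

namespace DelPezzoRing

variable (u w : Fin 3 → ℂ)

/-- The projection from the polynomial ring in five variables. -/
noncomputable def proj : MvPolynomial (Fin 5) ℂ →ₐ[ℂ] DelPezzoRing u w :=
  aeval ![⟨⟨X 0, 0⟩, 0⟩, ⟨⟨X 1, 0⟩, 0⟩, ⟨⟨X 2, 0⟩, 0⟩, ⟨⟨0, 1⟩, 0⟩, ⟨0, 1⟩]

/-- The inclusion of the polynomial ring in the first three variables. -/
noncomputable def incl : MvPolynomial (Fin 3) ℂ →ₐ[ℂ] MvPolynomial (Fin 5) ℂ :=
  rename (Fin.castAdd 2)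

theorem proj_incl (t : MvPolynomial (Fin 3) ℂ) : proj u w (incl t) = ⟨⟨t, 0⟩, 0⟩ := by
  have h : (proj u w).comp incl =
      (IsScalarTower.toAlgHom ℂ (QuadraticAlgebra (MvPolynomial (Fin 3) ℂ) (diagForm u) 0)
        (DelPezzoRing u w)).comp (IsScalarTower.toAlgHom ℂ (MvPolynomial (Fin 3) ℂ) _) := by
    ext i : 1
    simp only [AlgHom.comp_apply, incl, rename_X, proj, aeval_X]
    fin_cases i <;> rfl
  exact DFunLike.congr_fun h t

theorem proj_X_three : proj u w (X 3) = ⟨⟨0, 1⟩, 0⟩ := by simp [proj]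

theorem proj_X_four : proj u w (X 4) = ⟨0, 1⟩ := by simp [proj]

/-- The ideal of the surface. -/
noncomputable def surfaceIdeal : Ideal (MvPolynomial (Fin 5) ℂ) :=
  Ideal.span {X 3 ^ 2 - incl (diagForm u), X 4 ^ 2 - incl (diagForm w)}

theorem exists_normalForm (F : MvPolynomial (Fin 5) ℂ) : ∃ t₀ t₁ t₂ t₃ : MvPolynomial (Fin 3) ℂ,
    F - (incl t₀ + incl t₁ * X 3 + (incl t₂ + incl t₃ * X 3) * X 4) ∈ surfaceIdeal u w := by
  have h3 : (X 3 ^ 2 - incl (diagForm u)) ∈ surfaceIdeal u w := Ideal.subset_span (by simp)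
  have h4 : (X 4 ^ 2 - incl (diagForm w)) ∈ surfaceIdeal u w := Ideal.subset_span (by simp)
  induction F using MvPolynomial.induction_on with
  | C a => exact ⟨C a, 0, 0, 0, by simp [incl]⟩
  | add F G hF hG =>
    obtain ⟨t₀, t₁, t₂, t₃, ht⟩ := hF
    obtain ⟨s₀, s₁, s₂, s₃, hs⟩ := hG
    refine ⟨t₀ + s₀, t₁ + s₁, t₂ + s₂, t₃ + s₃, ?_⟩
    convert add_mem ht hs using 1
    simp only [map_add]
    ring
  | mul_X F i hF =>
    obtain ⟨t₀, t₁, t₂, t₃, ht⟩ := hF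
    have hx : ∀ j : Fin 3, i = Fin.castAdd 2 j → ∃ t₀ t₁ t₂ t₃ : MvPolynomial (Fin 3) ℂ,
        F * X i - (incl t₀ + incl t₁ * X 3 + (incl t₂ + incl t₃ * X 3) * X 4) ∈
          surfaceIdeal u w := by
      rintro j rfl
      refine ⟨t₀ * X j, t₁ * X j, t₂ * X j, t₃ * X j, ?_⟩
      have hj : incl (X j) = X (Fin.castAdd 2 j) := by simp [incl]
      convert (surfaceIdeal u w).mul_mem_left (X (Fin.castAdd 2 j)) ht using 1
      simp only [map_mul, hj]
      ring
    fin_cases i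
    · exact hx 0 rfl
    · exact hx 1 rfl
    · exact hx 2 rfl
    · refine ⟨t₁ * diagForm u, t₀, t₃ * diagForm u, t₂, ?_⟩
      convert add_mem ((surfaceIdeal u w).mul_mem_left (X 3) ht)
        ((surfaceIdeal u w).mul_mem_left (incl t₁ + incl t₃ * X 4) h3) using 1
      simp only [map_mul]
      dsimp
      ring
    · refine ⟨t₂ * diagForm w, t₃ * diagForm w, t₀, t₁, ?_⟩
      convert add_mem ((surfaceIdeal u w).mul_mem_left (X 4) ht)
        ((surfaceIdeal u w).mul_mem_left (incl t₂ + incl t₃ * X 3) h4) using 1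
      simp only [map_mul]
      dsimp
      ring

theorem proj_normalForm (t₀ t₁ t₂ t₃ : MvPolynomial (Fin 3) ℂ) :
    proj u w (incl t₀ + incl t₁ * X 3 + (incl t₂ + incl t₃ * X 3) * X 4) =
      ⟨⟨t₀, t₁⟩, ⟨t₂, t₃⟩⟩ := by
  simp only [map_add, map_mul, proj_incl, proj_X_three, proj_X_four]
  ext <;> simp

theorem proj_surjective : Function.Surjective (proj u w) := fun x =>
  ⟨_, proj_normalForm u w x.re.re x.re.im x.im.re x.im.im⟩

theorem surfaceIdeal_le_ker : surfaceIdeal u w ≤ RingHom.ker (proj u w) := by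
  rw [surfaceIdeal, Ideal.span_le]
  rintro _ (rfl | rfl)
  · simp only [SetLike.mem_coe, RingHom.mem_ker, map_sub, map_pow, proj_incl, proj_X_three]
    ext <;> simp [sq]
  · simp only [SetLike.mem_coe, RingHom.mem_ker, map_sub, map_pow, proj_incl, proj_X_four]
    rw [sub_eq_zero, sq, QuadraticAlgebra.mk_mul_mk]
    refine QuadraticAlgebra.ext (QuadraticAlgebra.ext ?_ ?_) (QuadraticAlgebra.ext ?_ ?_) <;>
      simp [QuadraticAlgebra.algebraMap_eq]

theorem ker_proj : RingHom.ker (proj u w) = surfaceIdeal u w := by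
  refine le_antisymm (fun F hF => ?_) (surfaceIdeal_le_ker u w)
  obtain ⟨t₀, t₁, t₂, t₃, ht⟩ := exists_normalForm u w F
  have h := surfaceIdeal_le_ker u w ht
  rw [RingHom.mem_ker, map_sub, RingHom.mem_ker.1 hF, proj_normalForm, zero_sub, neg_eq_zero] at h
  have h0 := congrArg (fun x => x.re.re) h
  have h1 := congrArg (fun x => x.re.im) h
  have h2 := congrArg (fun x => x.im.re) h
  have h3 := congrArg (fun x => x.im.im) h
  simp at h0 h1 h2 h3
  simpa [h0, h1, h2, h3] using ht

instance : IsNoetherianRing (DelPezzoRing u w) :=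
  isNoetherianRing_of_surjective _ _ (proj u w).toRingHom (proj_surjective u w)

variable {u w}

theorem dvd_of_dvd_incl_mul [IsDomain (DelPezzoRing u w)] {m₁ m₂ : MvPolynomial (Fin 3) ℂ}
    (hm : IsRelPrime m₁ m₂) (hm₁ : m₁ ≠ 0) {q f : DelPezzoRing u w}
    (h₁ : q ∣ proj u w (incl m₁) * f) (h₂ : q ∣ proj u w (incl m₂) * f) : q ∣ f := by
  obtain ⟨z₁, hz₁⟩ := h₁
  obtain ⟨z₂, hz₂⟩ := h₂
  have hne : proj u w (incl m₁) ≠ 0 := fun h => hm₁ (by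
    rw [proj_incl] at h
    exact congrArg (fun x => x.re.re) h)
  by_cases hq : q = 0
  · rw [hq, zero_mul] at hz₁
    rw [hq, (mul_eq_zero.1 hz₁).resolve_left hne]
  have h : proj u w (incl m₂) * z₁ = proj u w (incl m₁) * z₂ := by
    refine mul_left_cancel₀ hq ?_
    linear_combination proj u w (incl m₁) * hz₂ - proj u w (incl m₂) * hz₁
  rw [proj_incl, proj_incl] at h
  have h0 := congrArg (fun x => x.re.re) h
  have h1 := congrArg (fun x => x.re.im) h
  have h2 := congrArg (fun x => x.im.re) h
  have h3 := congrArg (fun x => x.im.im) h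
  simp at h0 h1 h2 h3
  obtain ⟨a0, ha0⟩ := hm.dvd_of_dvd_mul_left (Dvd.intro _ h0.symm)
  obtain ⟨a1, ha1⟩ := hm.dvd_of_dvd_mul_left (Dvd.intro _ h1.symm)
  obtain ⟨a2, ha2⟩ := hm.dvd_of_dvd_mul_left (Dvd.intro _ h2.symm)
  obtain ⟨a3, ha3⟩ := hm.dvd_of_dvd_mul_left (Dvd.intro _ h3.symm)
  have hz : z₁ = proj u w (incl m₁) * ⟨⟨a0, a1⟩, ⟨a2, a3⟩⟩ := by
    rw [proj_incl]
    ext <;> simp [ha0, ha1, ha2, ha3]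
  refine ⟨⟨⟨a0, a1⟩, ⟨a2, a3⟩⟩, mul_left_cancel₀ hne ?_⟩
  rw [hz₁, hz]
  ring

section

variable (hu : ∀ i, u i ≠ 0) (hw : ∀ i, w i ≠ 0) (huw : ∀ i j, i ≠ j → u i * w j - u j * w i ≠ 0)
include hu hw huw

theorem squarefree_mul_diagForm : Squarefree (diagForm u * diagForm w) :=
  squarefree_mul_iff.2 ⟨isRelPrime_diagForm huw, squarefree_diagForm hu, squarefree_diagForm hw⟩

theorem isDomain : IsDomain (DelPezzoRing u w) := by
  have := QuadraticAlgebra.isDomain_of_forall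
    fun a b => (squarefree_diagForm hu).eq_zero_of_sq_eq_mul_sq (a := a) (b := b)
      (not_isUnit_diagForm u)
  exact QuadraticAlgebra.isDomain_of_forall fun a b =>
    QuadraticAlgebra.eq_zero_of_sq_eq_tower two_ne_zero (squarefree_diagForm hu)
      (not_isUnit_diagForm u) (squarefree_diagForm hw) (not_isUnit_diagForm w)
      (squarefree_mul_diagForm hu hw huw) a b

theorem isIntegrallyClosed : IsIntegrallyClosed (DelPezzoRing u w) := by
  have hns := fun a b => (squarefree_diagForm hu).eq_zero_of_sq_eq_mul_sq (a := a) (b := b)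
      (not_isUnit_diagForm u)
  have := QuadraticAlgebra.isDomain_of_forall hns
  have h2 : IsUnit (2 : MvPolynomial (Fin 3) ℂ) := by
    rw [← map_ofNat C 2]
    exact (IsUnit.mk0 (2 : ℂ) two_ne_zero).map C
  have := QuadraticAlgebra.isIntegrallyClosed_of_forall h2 hns
    fun m a => (squarefree_diagForm hu).dvd_of_sq_dvd_sq_mul
  refine QuadraticAlgebra.isIntegrallyClosed_of_forall ?_ (fun a b =>
    QuadraticAlgebra.eq_zero_of_sq_eq_tower two_ne_zero (squarefree_diagForm hu)
      (not_isUnit_diagForm u) (squarefree_diagForm hw) (not_isUnit_diagForm w)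
      (squarefree_mul_diagForm hu hw huw) a b) fun m a hm =>
    QuadraticAlgebra.sq_dvd_tower h2 (squarefree_diagForm hu) (not_isUnit_diagForm u)
      (squarefree_diagForm hw) (squarefree_mul_diagForm hu hw huw) m a hm
  rw [← map_ofNat (algebraMap (MvPolynomial (Fin 3) ℂ) _) 2]
  exact h2.map _

theorem exists_prime_of_not_isRadical {Q : MvPolynomial (Fin 5) ℂ}
    (hr : ¬ (surfaceIdeal u w ⊔ Ideal.span {Q}).IsRadical) :
    ∃ p : Ideal (MvPolynomial (Fin 5) ℂ), p.IsPrime ∧ surfaceIdeal u w ⊔ Ideal.span {Q} ≤ p ∧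
      (∀ m₁ m₂, IsRelPrime m₁ m₂ → m₁ ≠ 0 → incl m₁ ∈ p → incl m₂ ∉ p) ∧
      ∃ f ∈ p, ∃ h ∈ p, ∃ s, s ∉ p ∧ s * Q - f * h ∈ surfaceIdeal u w := by
  have hdom := isDomain hu hw huw
  have hic := isIntegrallyClosed hu hw huw
  have hcomap : surfaceIdeal u w ⊔ Ideal.span {Q} =
      (Ideal.span {proj u w Q}).comap (proj u w) := by
    rw [← Set.image_singleton, ← Ideal.map_span, Ideal.comap_map_of_surjective _
      (proj_surjective u w), sup_comm]
    congr 1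
    exact (ker_proj u w).symm
  have hq : proj u w Q ≠ 0 := by
    intro h
    refine hr ?_
    rw [hcomap, h, Ideal.span_singleton_zero]
    exact (Ideal.comap_isPrime _ _).isRadical
  have hr' : ¬ (Ideal.span {proj u w Q}).IsRadical := fun h => hr (by
    rw [hcomap]
    exact h.comap _)
  obtain ⟨f, P, hP, hcol, hfP, h, hh, s, hs, he⟩ := exists_prime_colon hq hr'
  obtain ⟨f, rfl⟩ := proj_surjective u w f
  obtain ⟨h, rfl⟩ := proj_surjective u w h
  obtain ⟨s, rfl⟩ := proj_surjective u w s
  refine ⟨P.comap (proj u w), Ideal.comap_isPrime _ _, ?_, ?_, f, hfP, h, hh, s, hs, ?_⟩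
  · rw [hcomap]
    refine Ideal.comap_mono ((Ideal.span_singleton_le_iff_mem _).2 ?_)
    rw [hcol]
    exact dvd_mul_right _ _
  · intro m₁ m₂ hm hm₁ h₁ h₂
    rw [Ideal.mem_comap, hcol] at h₁ h₂
    refine hP.ne_top ((Ideal.eq_top_iff_one _).2 ((hcol 1).2 ?_))
    rw [one_mul]
    exact dvd_of_dvd_incl_mul hm hm₁ h₁ h₂
  · rw [← ker_proj, RingHom.mem_ker, map_sub, map_mul, map_mul, he]
    ring

end

end DelPezzoRing

theorem mem_range_algebraMap_of_forall_mul_mem {K : Type*} [Field K] [Algebra ℂ K]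
    {N : Submodule ℂ K} (hN : N ≠ ⊥) (hfg : N.FG) {x : K} (hx : ∀ n ∈ N, x * n ∈ N) :
    ∃ c : ℂ, algebraMap ℂ K c = x := by
  have hintegral : IsIntegral ℂ x := by
    obtain ⟨y, hy, hy0⟩ := (Submodule.ne_bot_iff _).1 hN
    refine isIntegral_of_smul_mem_submodule N ?_ hfg x hx
    exact fun h => hy0 (by simpa [h] using hy)
  exact minpoly.mem_range_of_degree_eq_one ℂ x
    (IsAlgClosed.degree_eq_one_of_irreducible ℂ (minpoly.irreducible hintegral))

theorem exists_eq_algebraMap_of_eigen {K ι : Type*} [Field K] [Algebra ℂ K] [Fintype ι] [Nontrivial ι]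
    {a b : ι → ℂ} (hab : ∀ i j, i ≠ j → a i * b j - a j * b i ≠ 0)
    (S : ι → ι → ℂ) {ξ : ι → K} (hξ : ξ ≠ 0) (ha : ∑ i, a i • ξ i ^ 2 = 0)
    (hb : ∑ i, b i • ξ i ^ 2 = 0) {α β : K}
    (hS : ∀ i, ∑ j, S i j • ξ j = (a i • α + b i • β) * ξ i) : ∃ c : ℂ, algebraMap ℂ K c = α := by
  classical
  let N : Submodule ℂ K := Submodule.span ℂ (Set.range fun t : ι × ι × ι => ξ t.1 * ξ t.2.1 * ξ t.2.2)
  have hN : ∀ i j k, ξ i * ξ j * ξ k ∈ N := fun i j k => Submodule.subset_span ⟨(i, j, k), rfl⟩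
  have hσ : ∀ i j k, (∑ l, S i l • ξ l) * ξ j * ξ k ∈ N := fun i j k => by
    rw [Finset.sum_mul, Finset.sum_mul]
    refine sum_mem fun l _ => ?_
    rw [smul_mul_assoc, smul_mul_assoc]
    exact N.smul_mem _ (hN _ _ _)
  have hne : ∀ i j k, i ≠ j → α * (ξ i * ξ j * ξ k) ∈ N := fun i j k hij => by
    refine (N.smul_mem_iff (hab i j hij)).1 ?_
    convert sub_mem (N.smul_mem (b j) (hσ i j k)) (N.smul_mem (b i) (hσ j i k)) using 1
    rw [hS, hS]
    simp only [Algebra.smul_def, map_sub, map_mul]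
    ring
  obtain ⟨i, hi⟩ := Function.ne_iff.1 hξ
  refine mem_range_algebraMap_of_forall_mul_mem (N := N) ((Submodule.ne_bot_iff _).2
    ⟨_, hN i i i, by simpa using hi⟩) (Submodule.fg_span (Set.finite_range _)) fun n hn => ?_
  have hcube : ∀ (c : ι → ℂ) i, c i ≠ 0 → ∑ i, c i • ξ i ^ 2 = 0 → α * (ξ i * ξ i * ξ i) ∈ N := by
    intro c i hc hsum
    refine (N.smul_mem_iff hc).1 ?_
    rw [← Finset.add_sum_erase _ _ (Finset.mem_univ i), add_eq_zero_iff_eq_neg] at hsum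
    have : c i • (α * (ξ i * ξ i * ξ i)) = -∑ l ∈ Finset.univ.erase i, c l • (α * (ξ i * ξ l * ξ l)) := by
      calc _ = α * ξ i * (c i • ξ i ^ 2) := by simp only [Algebra.smul_def]; ring
        _ = _ := by
          rw [hsum, mul_neg, Finset.mul_sum]
          congr 1
          refine Finset.sum_congr rfl fun l _ => ?_
          simp only [Algebra.smul_def]; ring
    rw [this]
    exact neg_mem (sum_mem fun l hl => N.smul_mem _ (hne _ _ _ (Finset.ne_of_mem_erase hl).symm))
  refine Submodule.span_induction ?_ (by simp) (fun x y _ _ hx hy => ?_) (fun c x _ hx => ?_) hn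
  · rintro _ ⟨⟨i, j, k⟩, rfl⟩
    dsimp only
    by_cases hij : i = j
    · by_cases hik : i = k
      · subst hij hik
        obtain ⟨l, hl⟩ := exists_ne i
        by_cases hai : a i = 0
        · exact hcube b i (fun hbi => hab i l hl.symm (by simp [hai, hbi])) hb
        · exact hcube a i hai ha
      · rw [mul_right_comm]
        exact hne _ _ _ hik
    · exact hne _ _ _ hij
  · rw [mul_add]
    exact add_mem hx hy
  · rw [mul_smul_comm]
    exact N.smul_mem _ hx

/-- The quadratic form with matrix `S`. -/
noncomputable def quadForm {n : ℕ} (S : Matrix (Fin n) (Fin n) ℂ) : MvPolynomial (Fin n) ℂ :=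
  ∑ i, X i * linForm (S i)

theorem pderiv_linForm {n : ℕ} (v : Fin n → ℂ) (k : Fin n) : pderiv k (linForm v) = C (v k) := by
  rw [linForm_apply, map_sum, Finset.sum_eq_single k]
  · rw [Derivation.map_smul, pderiv_X_self, smul_eq_C_mul, mul_one]
  · intro j _ hj
    rw [Derivation.map_smul, pderiv_X_of_ne hj, smul_zero]
  · simp

theorem pderiv_quadForm {n : ℕ} {S : Matrix (Fin n) (Fin n) ℂ} (hS : S.IsSymm) (k : Fin n) :
    pderiv k (quadForm S) = 2 * linForm (S k) := by
  have h : ∀ i, pderiv k (X i * linForm (S i)) = X i * C (S i k) + (pderiv k (X i)) * linForm (S i) := by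
    intro i
    rw [Derivation.leibniz, pderiv_linForm, smul_eq_mul, smul_eq_mul, mul_comm (linForm _)]
  rw [quadForm, map_sum, Finset.sum_congr rfl fun i _ => h i, Finset.sum_add_distrib, two_mul]
  congr 1
  · rw [linForm_apply]
    exact Finset.sum_congr rfl fun i _ => by rw [smul_eq_C_mul, mul_comm, hS.apply]
  · rw [Finset.sum_eq_single k, pderiv_X_self, one_mul]
    · intro j _ hj
      rw [pderiv_X_of_ne hj, zero_mul]
    · simp

/-- The vectors of coefficients of the linear forms in an ideal. -/
noncomputable def linPart {n : ℕ} (p : Ideal (MvPolynomial (Fin n) ℂ)) : Submodule ℂ (Fin n → ℂ) :=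
  (p.restrictScalars ℂ).comap linForm

theorem mem_linPart {n : ℕ} {p : Ideal (MvPolynomial (Fin n) ℂ)} {v : Fin n → ℂ} :
    v ∈ linPart p ↔ linForm v ∈ p := Iff.rfl

theorem diagForm_smul_add_smul {n : ℕ} (s t : ℂ) (u w : Fin n → ℂ) :
    diagForm (s • u + t • w) = C s * diagForm u + C t * diagForm w := by
  simp only [diagForm, Finset.mul_sum, ← Finset.sum_add_distrib, smul_eq_C_mul, C_mul, C_add,
    Pi.add_apply, Pi.smul_apply, smul_eq_mul]
  exact Finset.sum_congr rfl fun i _ => by ring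

theorem span_diagForm_eq_surfaceIdeal {a b : Fin 5 → ℂ} (hd : a 3 * b 4 - a 4 * b 3 ≠ 0) :
    Ideal.span {diagForm a, diagForm b} = DelPezzoRing.surfaceIdeal
      (fun i => (a 4 * b (i.castAdd 2) - a (i.castAdd 2) * b 4) / (a 3 * b 4 - a 4 * b 3))
      (fun i => (a (i.castAdd 2) * b 3 - a 3 * b (i.castAdd 2)) / (a 3 * b 4 - a 4 * b 3)) := by
  generalize hd' : a 3 * b 4 - a 4 * b 3 = d at hd
  have h3 : ∀ u : Fin 3 → ℂ, X 3 ^ 2 - DelPezzoRing.incl (diagForm u) =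
      diagForm ![-u 0, -u 1, -u 2, 1, 0] := fun u => by
    simp [DelPezzoRing.incl, diagForm, Fin.sum_univ_succ]
    ring
  have h4 : ∀ u : Fin 3 → ℂ, X 4 ^ 2 - DelPezzoRing.incl (diagForm u) =
      diagForm ![-u 0, -u 1, -u 2, 0, 1] := fun u => by
    simp [DelPezzoRing.incl, diagForm, Fin.sum_univ_succ]
    ring
  rw [DelPezzoRing.surfaceIdeal, h3, h4]
  refine le_antisymm (Ideal.span_le.2 ?_) (Ideal.span_le.2 ?_) <;> rintro _ (rfl | rfl) <;>
    refine Ideal.mem_span_pair.2 ?_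
  · refine ⟨C (a 3), C (a 4), ?_⟩
    rw [← diagForm_smul_add_smul]
    congr 1
    ext i
    fin_cases i <;> simp <;> field_simp <;> rw [← hd'] <;> ring
  · refine ⟨C (b 3), C (b 4), ?_⟩
    rw [← diagForm_smul_add_smul]
    congr 1
    ext i
    fin_cases i <;> simp <;> field_simp <;> rw [← hd'] <;> ring
  · refine ⟨C (b 4 / d), C (-a 4 / d), ?_⟩
    rw [← diagForm_smul_add_smul]
    congr 1
    ext i
    fin_cases i <;> simp <;> field_simp <;> (try rw [← hd']) <;> ring
  · refine ⟨C (-b 3 / d), C (a 3 / d), ?_⟩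
    rw [← diagForm_smul_add_smul]
    congr 1
    ext i
    fin_cases i <;> simp <;> field_simp <;> (try rw [← hd']) <;> ring

theorem finrank_linPart_le {p : Ideal (MvPolynomial (Fin 5) ℂ)}
    (hp : ∀ m₁ m₂, IsRelPrime m₁ m₂ → m₁ ≠ 0 → DelPezzoRing.incl m₁ ∈ p →
      DelPezzoRing.incl m₂ ∉ p) : Module.finrank ℂ (linPart p) ≤ 3 := by
  by_contra! hcon
  let e : (Fin 3 → ℂ) →ₗ[ℂ] (Fin 5 → ℂ) := LinearMap.pi
    ![LinearMap.proj 0, LinearMap.proj 1, LinearMap.proj 2, 0, 0]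
  have he : ∀ v, linForm (e v) = DelPezzoRing.incl (linForm v) := fun v => by
    simp [linForm_apply, DelPezzoRing.incl, Fin.sum_univ_succ, e]
  have hinj : Function.Injective e := fun v w h => by
    ext i
    fin_cases i
    · exact congrFun h 0
    · exact congrFun h 1
    · exact congrFun h 2
  have h1 : 1 < Module.finrank ℂ ((linPart p).comap e) := by
    have h2 := (Submodule.equivMapOfInjective e hinj ((linPart p).comap e)).finrank_eq
    have h3 := Submodule.finrank_sup_add_finrank_inf_eq (linPart p) (LinearMap.range e)
    rw [Submodule.map_comap_eq, inf_comm] at h2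
    rw [LinearMap.finrank_range_of_inj hinj] at h3
    have h4 := Submodule.finrank_le (linPart p ⊔ LinearMap.range e)
    simp at h3 h4
    omega
  have := Module.nontrivial_of_finrank_pos (zero_lt_one.trans h1)
  obtain ⟨v, hv⟩ := exists_ne (0 : (linPart p).comap e)
  obtain ⟨w, hw⟩ := exists_linearIndependent_pair_of_one_lt_finrank h1 hv
  have hli : LinearIndependent ℂ ![(v : Fin 3 → ℂ), w] := by
    have := hw.map' ((linPart p).comap e).subtype (Submodule.ker_subtype _)
    rwa [show ⇑((linPart p).comap e).subtype ∘ ![v, w] = ![(v : Fin 3 → ℂ), w] by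
      ext i : 1
      fin_cases i <;> rfl] at this
  refine hp _ _ (isRelPrime_linForm hli) ?_ (he v ▸ v.2) (he w ▸ w.2)
  intro h
  exact hv (Subtype.ext (linForm_injective (by simpa using h)))

theorem exists_linForm_mem_of_not_isRadical {a b : Fin 5 → ℂ}
    (hab : ∀ i j, i ≠ j → a i * b j - a j * b i ≠ 0) {S : Matrix (Fin 5) (Fin 5) ℂ}
    (hS : S.IsSymm) (hr : ¬ (Ideal.span {diagForm a, diagForm b, quadForm S}).IsRadical) :
    ∃ p : Ideal (MvPolynomial (Fin 5) ℂ), p.IsPrime ∧ diagForm a ∈ p ∧ diagForm b ∈ p ∧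
      Module.finrank ℂ (linPart p) ≤ 3 ∧
      ∃ α β : ℂ, ∀ i, linForm (S i) - C (a i * α + b i * β) * X i ∈ p := by
  have hd := hab 3 4 (by decide)
  have hspan : Ideal.span {diagForm a, diagForm b, quadForm S} =
      Ideal.span {diagForm a, diagForm b} ⊔ Ideal.span {quadForm S} := by
    rw [← Ideal.span_union]
    congr 1
    ext x
    simp only [Set.mem_insert_iff, Set.mem_singleton_iff, Set.mem_union, or_assoc]
  rw [hspan] at hr
  have hI := span_diagForm_eq_surfaceIdeal hd
  rw [hI] at hr
  have hne : ∀ i : Fin 3, i.castAdd 2 ≠ (3 : Fin 5) ∧ i.castAdd 2 ≠ (4 : Fin 5) := by decide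
  obtain ⟨p, hp, hle, hrel, f, hf, h, hh, s, hs, he⟩ :=
    DelPezzoRing.exists_prime_of_not_isRadical
      (fun i => div_ne_zero (hab 4 (i.castAdd 2) (hne i).2.symm) hd)
      (fun i => div_ne_zero (hab (i.castAdd 2) 3 (hne i).1) hd) (fun i j hij => by
        have hij' : i.castAdd 2 ≠ j.castAdd 2 := fun h => hij (Fin.castAdd_injective _ _ h)
        convert div_ne_zero (hab _ _ hij') hd using 1
        rw [div_mul_div_comm, div_mul_div_comm, ← sub_div, div_eq_div_iff (mul_ne_zero hd hd) hd]
        ring) hr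
  rw [← hI] at hle he
  have hP := Ideal.span_le.1 (le_sup_left.trans hle)
  have ha : diagForm a ∈ p := hP (by simp)
  have hb : diagForm b ∈ p := hP (by simp)
  refine ⟨p, hp, ha, hb, finrank_linPart_le hrel, ?_⟩
  obtain ⟨c₁, c₂, hc⟩ := Ideal.mem_span_pair.1 he
  have hder : ∀ i, s * linForm (S i) - (C (a i) * c₁ + C (b i) * c₂) * X i ∈ p := fun i => by
    have hQ : quadForm S ∈ p := hle (Ideal.mem_sup_right (Ideal.mem_span_singleton_self _))
    have h2 := congrArg (pderiv i) hc
    simp only [map_add, map_sub, Derivation.leibniz, smul_eq_mul, pderiv_diagForm,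
      pderiv_quadForm hS, smul_eq_C_mul, C_mul] at h2
    have h3 : C 2 * (s * linForm (S i) - (C (a i) * c₁ + C (b i) * c₂) * X i) ∈ p := by
      have : C 2 * (s * linForm (S i) - (C (a i) * c₁ + C (b i) * c₂) * X i) =
          diagForm a * pderiv i c₁ + diagForm b * pderiv i c₂ - quadForm S * pderiv i s +
          f * pderiv i h + h * pderiv i f := by
        have h2' : (C 2 : MvPolynomial (Fin 5) ℂ) = 2 := map_ofNat C 2
        rw [h2'] at h2 ⊢
        linear_combination -h2
      rw [this]
      exact add_mem (add_mem (sub_mem (add_mem (p.mul_mem_right _ ha) (p.mul_mem_right _ hb))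
        (p.mul_mem_right _ hQ)) (p.mul_mem_right _ hf)) (p.mul_mem_right _ hh)
    refine (hp.mem_or_mem h3).resolve_left fun h4 => hp.ne_top ?_
    exact Ideal.eq_top_of_isUnit_mem _ h4 ((IsUnit.mk0 (2 : ℂ) two_ne_zero).map C)
  let K := FractionRing (MvPolynomial (Fin 5) ℂ ⧸ p)
  let φ : MvPolynomial (Fin 5) ℂ →ₐ[ℂ] K :=
    (IsScalarTower.toAlgHom ℂ (MvPolynomial (Fin 5) ℂ ⧸ p) K).comp (Ideal.Quotient.mkₐ ℂ p)
  have hφ : ∀ x, φ x = 0 ↔ x ∈ p := fun x => by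
    simp [φ, Ideal.Quotient.eq_zero_iff_mem]
  have hφC : ∀ c, φ (C c) = algebraMap ℂ K c := fun c => φ.commutes c
  have hφs : φ s ≠ 0 := fun h => hs ((hφ s).1 h)
  have hdiag : ∀ v : Fin 5 → ℂ, diagForm v ∈ p → ∑ i, v i • φ (X i) ^ 2 = 0 := fun v hv => by
    simpa [diagForm] using (hφ _).2 hv
  have heq : ∀ i, ∑ j, S i j • φ (X j) =
      (a i • (φ c₁ / φ s) + b i • (φ c₂ / φ s)) * φ (X i) := fun i => by
    have h5 := (hφ _).2 (hder i)
    simp only [linForm_apply, map_sub, map_mul, map_add, hφC, map_sum, map_smul] at h5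
    simp only [Algebra.smul_def] at h5 ⊢
    have h₁ : φ s * (φ c₁ / φ s) = φ c₁ := mul_div_cancel₀ _ hφs
    have h₂ : φ s * (φ c₂ / φ s) = φ c₂ := mul_div_cancel₀ _ hφs
    refine mul_left_cancel₀ hφs ?_
    linear_combination h5 - algebraMap ℂ K (a i) * φ (X i) * h₁ -
      algebraMap ℂ K (b i) * φ (X i) * h₂
  have hξ : (fun i => φ (X i)) ≠ 0 := fun h0 => by
    have hX : ∀ i : Fin 3, DelPezzoRing.incl (linForm (Pi.single i 1)) ∈ p := fun i => by
      have := (hφ _).1 (congrFun h0 (i.castAdd 2))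
      simpa [linForm_apply, Pi.single_apply, DelPezzoRing.incl] using this
    refine hrel _ _ (isRelPrime_linForm (LinearIndependent.pair_iff.2 fun s t hst => ⟨?_, ?_⟩)) ?_ (hX 0) (hX 1)
    · simpa using congrFun hst 0
    · simpa using congrFun hst 1
    · intro h
      have := congrFun (linForm_injective (h.trans (map_zero linForm).symm)) 0
      simp at this
  obtain ⟨α, hα⟩ := exists_eq_algebraMap_of_eigen hab S hξ (hdiag a ha) (hdiag b hb) heq
  obtain ⟨β, hβ⟩ := exists_eq_algebraMap_of_eigen (a := b) (b := a)
    (fun i j hij h => hab i j hij (by linear_combination -h)) S hξ (hdiag b hb) (hdiag a ha)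
    fun i => by rw [heq, add_comm]
  refine ⟨α, β, fun i => (hφ _).1 ?_⟩
  rw [← hα, ← hβ] at heq
  have := heq i
  simp only [linForm_apply, map_sub, map_mul, map_add, hφC, map_sum, map_smul, this]
  simp only [Algebra.smul_def]
  ring
theorem quadForm_add {n : ℕ} (S T : Matrix (Fin n) (Fin n) ℂ) :
    quadForm (S + T) = quadForm S + quadForm T := by
  simp only [quadForm, ← Finset.sum_add_distrib, ← mul_add, ← map_add]
  rfl

theorem quadForm_smul {n : ℕ} (c : ℂ) (S : Matrix (Fin n) (Fin n) ℂ) :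
    quadForm (c • S) = c • quadForm S := by
  simp only [quadForm, Finset.smul_sum, ← mul_smul_comm, ← map_smul]
  rfl

theorem quadForm_diagonal {n : ℕ} (u : Fin n → ℂ) : quadForm (Matrix.diagonal u) = diagForm u := by
  refine Finset.sum_congr rfl fun i _ => ?_
  rw [linForm_apply, Finset.sum_eq_single i]
  · rw [Matrix.diagonal_apply_eq, mul_smul_comm, sq]
  · intro j _ hj
    rw [Matrix.diagonal_apply_ne _ hj.symm, zero_smul]
  · simp

theorem quadForm_eq_sum {n : ℕ} (S : Matrix (Fin n) (Fin n) ℂ) :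
    quadForm S = ∑ i, ∑ j, S i j • (X i * X j) := by
  simp only [quadForm, linForm_apply, Finset.mul_sum, mul_smul_comm]

theorem aeval_linForm_quadForm {n : ℕ} (g S : Matrix (Fin n) (Fin n) ℂ) :
    aeval (fun i => linForm (g i)) (quadForm S) = quadForm (g.transpose * S * g) := by
  have h : ∀ v, aeval (fun i => linForm (g i)) (linForm v) = linForm (Matrix.vecMul v g) := fun v => by
    rw [linForm_apply, map_sum]
    simp only [map_smul, aeval_X]
    simp only [← map_smul, ← map_sum, Matrix.vecMul_eq_sum]
  simp only [quadForm, map_sum, map_mul, aeval_X, h]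
  simp only [linForm_apply (g _), Finset.sum_mul, smul_mul_assoc]
  rw [Finset.sum_comm]
  refine Finset.sum_congr rfl fun i _ => ?_
  simp only [← mul_smul_comm, ← Finset.mul_sum, ← map_smul, ← map_sum]
  congr 2
  ext j
  simp only [Matrix.mul_apply, Finset.sum_apply, Pi.smul_apply, smul_eq_mul, Matrix.vecMul,
    dotProduct, Matrix.transpose_apply, Finset.mul_sum, Finset.sum_mul]
  rw [Finset.sum_comm]
  exact Finset.sum_congr rfl fun _ _ => Finset.sum_congr rfl fun _ _ => by ring

theorem exists_adapted_matrix {m l : ℕ} {L : Submodule ℂ (Fin (m + l) → ℂ)}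
    (hL : Module.finrank ℂ L = l) : ∃ g h : Matrix (Fin (m + l)) (Fin (m + l)) ℂ,
      g * h = 1 ∧ h * g = 1 ∧
      (∀ v ∈ L, ∀ k : Fin m, Matrix.vecMul v g (k.castAdd l) = 0) ∧
      ∀ k : Fin l, h (k.natAdd m) ∈ L := by
  have hQ : Module.finrank ℂ ((Fin (m + l) → ℂ) ⧸ L) = m := by
    have := L.finrank_quotient_add_finrank
    simp only [hL, Module.finrank_fin_fun] at this
    omega
  let bL := Module.finBasisOfFinrankEq ℂ L hL
  let bQ := Module.finBasisOfFinrankEq ℂ _ hQ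
  let b := (bL.sumQuot bQ).reindex ((Equiv.sumComm _ _).trans finSumFinEquiv)
  have hb : ∀ v ∈ L, ∀ k : Fin m, b.repr v (k.castAdd l) = 0 := fun v hv k => by
    rw [Module.Basis.repr_reindex_apply]
    simp [(Submodule.Quotient.mk_eq_zero L).2 hv]
  have hb' : ∀ k : Fin l, b (k.natAdd m) ∈ L := fun k => by simp [b]
  let h : Matrix (Fin (m + l)) (Fin (m + l)) ℂ := Matrix.of fun k i => b k i
  have hh : IsUnit h.det := by
    have : h = ((Pi.basisFun ℂ (Fin (m + l))).toMatrix b).transpose := by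
      ext i j
      simp [h, Module.Basis.toMatrix_apply]
    rw [this, Matrix.det_transpose]
    have := (Pi.basisFun ℂ (Fin (m + l))).invertibleToMatrix b
    exact (Matrix.isUnit_iff_isUnit_det _).1 (isUnit_of_invertible _)
  refine ⟨h⁻¹, h, Matrix.nonsing_inv_mul _ hh, Matrix.mul_nonsing_inv _ hh, fun v hv k => ?_, hb'⟩
  have hv' : v = Matrix.vecMul (b.repr v) h := by
    rw [Matrix.vecMul_eq_sum]
    exact (b.sum_repr v).symm
  rw [hv', Matrix.vecMul_vecMul, Matrix.mul_nonsing_inv _ hh, Matrix.vecMul_one]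
  exact hb v hv k

theorem exists_matrix_of_finrank_linPart {m l : ℕ} {p : Ideal (MvPolynomial (Fin (m + l)) ℂ)}
    (hL : Module.finrank ℂ (linPart p) = l) : ∃ g h : Matrix (Fin (m + l)) (Fin (m + l)) ℂ,
      g * h = 1 ∧ h * g = 1 ∧
      (∀ S : Matrix _ _ ℂ, S.IsSymm → (∀ i, linForm (S i) ∈ p) → ∀ k k' : Fin (m + l),
        k.1 < m ∨ k'.1 < m → (g.transpose * S * g) k k' = 0) ∧
      ∃ η : Fin m → MvPolynomial (Fin (m + l)) ℂ ⧸ p,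
        (∀ c : Fin m → ℂ, ∑ k, c k • η k = 0 → c = 0) ∧
        ∀ S, quadForm S ∈ p → ∑ k : Fin m, ∑ k' : Fin m,
          (g.transpose * S * g) (k.castAdd l) (k'.castAdd l) • (η k * η k') = 0 := by
  obtain ⟨g, h, hgh, hhg, hg, hh⟩ := exists_adapted_matrix hL
  let φ := Ideal.Quotient.mkₐ ℂ p
  have hφ : ∀ x, φ x = 0 ↔ x ∈ p := fun x => Ideal.Quotient.eq_zero_iff_mem
  refine ⟨g, h, hgh, hhg, fun S hS hSp k k' hkk => ?_, fun k => φ (linForm (h (k.castAdd l))), fun c hc => ?_, ?_⟩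
  · have key : ∀ k k', k'.1 < m → (g.transpose * S * g) k k' = 0 := fun k k' hk => by
      rw [Matrix.mul_assoc, Matrix.mul_apply]
      refine Finset.sum_eq_zero fun i _ => ?_
      have : (S * g) i k' = 0 := hg _ (hSp i) ⟨k', hk⟩
      rw [this, mul_zero]
    rcases hkk with hk | hk
    · have hsym : (g.transpose * S * g).IsSymm := by
        rw [Matrix.IsSymm, Matrix.transpose_mul, Matrix.transpose_mul, hS.eq,
          Matrix.transpose_transpose, Matrix.mul_assoc]
      rw [← hsym.apply]
      exact key _ _ hk
    · exact key _ _ hk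
  · ext j
    have hc' : ∑ k, c k • h (k.castAdd l) ∈ linPart p := by
      rw [mem_linPart, ← hφ, ← hc]
      simp only [map_sum, map_smul]
    have h1 := hg _ hc' j
    rw [Matrix.sum_vecMul, Finset.sum_apply, Finset.sum_eq_single j] at h1
    · have h2 : Matrix.vecMul (h (j.castAdd l)) g (j.castAdd l) = 1 := by
        change (h * g) _ _ = 1
        rw [hhg, Matrix.one_apply_eq]
      rw [Matrix.smul_vecMul, Pi.smul_apply, h2] at h1
      simpa using h1
    · intro k _ hk
      have h2 : Matrix.vecMul (h (k.castAdd l)) g (j.castAdd l) = 0 := by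
        change (h * g) _ _ = 0
        rw [hhg, Matrix.one_apply_ne (fun h => hk (Fin.castAdd_injective _ _ h))]
      rw [Matrix.smul_vecMul, Pi.smul_apply, h2, smul_zero]
    · simp
  · intro S hSp
    have hη : ∀ k : Fin l, φ (linForm (h (k.natAdd m))) = 0 := fun k => (hφ _).2 (hh k)
    have h1 : h.transpose * (g.transpose * S * g) * h = S := by
      calc _ = (g * h).transpose * S * (g * h) := by
            rw [Matrix.transpose_mul]
            simp only [Matrix.mul_assoc]
        _ = S := by rw [hgh]; simp
    rw [← hφ, ← h1, ← aeval_linForm_quadForm, quadForm_eq_sum] at hSp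
    simpa [Fin.sum_univ_add, hη] using hSp

theorem eq_zero_of_binary_relation {D : Type*} [CommRing D] [IsDomain D] [Algebra ℂ D] {y z : D}
    (h : ∀ s t : ℂ, s • y + t • z = 0 → s = 0 ∧ t = 0) {a b c : ℂ}
    (e : a • (y * y) + (2 * b) • (y * z) + c • (z * z) = 0) : a = 0 ∧ b = 0 ∧ c = 0 := by
  have ha : a = 0 := by
    by_contra ha
    obtain ⟨r, hr⟩ := IsAlgClosed.exists_pow_nat_eq (b ^ 2 - a * c) two_pos
    have hr' := congrArg (algebraMap ℂ D) hr
    simp only [Algebra.smul_def, map_mul, map_sub, map_pow, map_ofNat] at e hr'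
    have : (a • y + (b + r) • z) * (a • y + (b - r) • z) = 0 := by
      simp only [Algebra.smul_def, map_add, map_sub]
      linear_combination algebraMap ℂ D a * e - z * z * hr'
    rcases mul_eq_zero.1 this with h0 | h0
    · exact ha (h _ _ h0).1
    · exact ha (h _ _ h0).1
  have hz : z ≠ 0 := fun hz => one_ne_zero (h 0 1 (by simp [hz])).2
  subst ha
  have : z * ((2 * b) • y + c • z) = 0 := by
    rw [← e]
    simp only [Algebra.smul_def, map_zero]
    ring
  have := h _ _ ((mul_eq_zero.1 this).resolve_left hz)
  exact ⟨rfl, by simpa using this.1, this.2⟩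

theorem eq_zero_of_ternary_relation {D : Type*} [CommRing D] [IsDomain D] [Algebra ℂ D]
    {x y z : D} (h : ∀ s t u : ℂ, s • x + t • y + u • z = 0 → s = 0 ∧ t = 0 ∧ u = 0)
    {a b c d e f p q r : ℂ} (hr : r ≠ 0) (h₁ : a * p + d * q + e * r = 0)
    (h₂ : d * p + b * q + f * r = 0) (h₃ : e * p + f * q + c * r = 0)
    (hq : a • (x * x) + b • (y * y) + c • (z * z) + (2 * d) • (x * y) + (2 * e) • (x * z) +
      (2 * f) • (y * z) = 0) : a = 0 ∧ b = 0 ∧ c = 0 ∧ d = 0 ∧ e = 0 ∧ f = 0 := by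
  have hab := eq_zero_of_binary_relation (y := r • x - p • z) (z := r • y - q • z) (a := a)
    (b := d) (c := b) (fun s t hst => ?_) ?_
  · obtain ⟨rfl, rfl, rfl⟩ := hab
    have he : e = 0 := by simpa [hr] using h₁
    have hf : f = 0 := by simpa [hr] using h₂
    subst he hf
    exact ⟨rfl, rfl, by simpa [hr] using h₃, rfl, rfl, rfl⟩
  · have := h (s * r) (t * r) (-(s * p + t * q)) (by
      rw [← hst]
      module)
    simpa [hr] using And.intro this.1 this.2.1
  · have h₁' := congrArg (algebraMap ℂ D) h₁
    have h₂' := congrArg (algebraMap ℂ D) h₂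
    have h₃' := congrArg (algebraMap ℂ D) h₃
    simp only [Algebra.smul_def, map_mul, map_add, map_ofNat, map_zero] at h₁' h₂' h₃' hq ⊢
    generalize algebraMap ℂ D a = a at *
    generalize algebraMap ℂ D b = b at *
    generalize algebraMap ℂ D c = c at *
    generalize algebraMap ℂ D d = d at *
    generalize algebraMap ℂ D e = e at *
    generalize algebraMap ℂ D f = f at *
    generalize algebraMap ℂ D p = p at *
    generalize algebraMap ℂ D q = q at *
    generalize algebraMap ℂ D r = r at *
    linear_combination r ^ 2 * hq - (2 * r * z * x) * h₁' - (2 * r * z * y) * h₂' +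
      z ^ 2 * (p * h₁' + q * h₂' - r * h₃')

theorem eq_zero_of_mulVec_eq_zero_of_ternary_relation {D : Type*} [CommRing D] [IsDomain D]
    [Algebra ℂ D] {η : Fin 3 → D} (hη : ∀ c : Fin 3 → ℂ, ∑ k, c k • η k = 0 → c = 0)
    {T : Matrix (Fin 3) (Fin 3) ℂ} (hTs : T.IsSymm)
    (hT0 : ∑ k, ∑ l, T k l • (η k * η l) = 0) {v : Fin 3 → ℂ} (hv : v ≠ 0)
    (hTv : T.mulVec v = 0) : T = 0 := by
  have h10 := hTs.apply 0 1
  have h20 := hTs.apply 0 2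
  have h21 := hTs.apply 1 2
  replace hTv : ∀ k, T k 0 * v 0 + T k 1 * v 1 + T k 2 * v 2 = 0 := fun k => by
    simpa [Matrix.mulVec, dotProduct, Fin.sum_univ_three] using congrFun hTv k
  have h0 := hTv 0
  have h1 := hTv 1
  have h2 := hTv 2
  have hli : ∀ c₀ c₁ c₂ : ℂ, c₀ • η 0 + c₁ • η 1 + c₂ • η 2 = 0 → c₀ = 0 ∧ c₁ = 0 ∧ c₂ = 0 := by
    intro c₀ c₁ c₂ hc
    have := hη ![c₀, c₁, c₂] (by simpa [Fin.sum_univ_three] using hc)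
    exact ⟨congrFun this 0, congrFun this 1, congrFun this 2⟩
  simp only [Fin.sum_univ_three, h10, h20, h21] at hT0 h0 h1 h2
  have hfin : T 0 0 = 0 ∧ T 1 1 = 0 ∧ T 2 2 = 0 ∧ T 0 1 = 0 ∧ T 0 2 = 0 ∧ T 1 2 = 0 := by
    obtain ⟨k, hk⟩ := Function.ne_iff.1 hv
    have h1' := mul_comm (η 1) (η 0)
    have h2' := mul_comm (η 2) (η 0)
    have h3' := mul_comm (η 2) (η 1)
    rw [h1', h2', h3'] at hT0
    fin_cases k
    · obtain ⟨h11, h22, h00, h12, h01, h02⟩ := eq_zero_of_ternary_relation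
        (fun a b c h => by
          have := hli c a b (by rw [← h]; abel)
          tauto) (r := v 0) hk (a := T 1 1) (b := T 2 2) (c := T 0 0) (d := T 1 2) (e := T 0 1)
        (f := T 0 2) (p := v 1) (q := v 2) (x := η 1) (y := η 2) (z := η 0)
        (by linear_combination h1) (by linear_combination h2) (by linear_combination h0)
        (by rw [← hT0, h1', h2']; module)
      exact ⟨h00, h11, h22, h01, h02, h12⟩
    · obtain ⟨h00, h22, h11, h02, h01, h12⟩ := eq_zero_of_ternary_relation
        (fun a b c h => by
          have := hli a c b (by rw [← h]; abel)
          tauto) (r := v 1) hk (a := T 0 0) (b := T 2 2) (c := T 1 1) (d := T 0 2) (e := T 0 1)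
        (f := T 1 2) (p := v 0) (q := v 2) (x := η 0) (y := η 2) (z := η 1)
        (by linear_combination h0) (by linear_combination h2) (by linear_combination h1)
        (by rw [← hT0, h3']; module)
      exact ⟨h00, h11, h22, h01, h02, h12⟩
    · exact eq_zero_of_ternary_relation hli hk h0 h1 h2 (by rw [← hT0]; module)
  obtain ⟨h00, h11, h22, h01, h02, h12⟩ := hfin
  ext i j
  fin_cases i <;> fin_cases j <;> simp [h00, h11, h22, h01, h02, h12, h10, h20, h21]

theorem exists_pencil_eq_zero {D : Type*} [CommRing D] [IsDomain D] [Algebra ℂ D] {η : Fin 3 → D}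
    (hη : ∀ c : Fin 3 → ℂ, ∑ k, c k • η k = 0 → c = 0) {M N : Matrix (Fin 3) (Fin 3) ℂ}
    (hM : M.IsSymm) (hN : N.IsSymm) (hM0 : ∑ k, ∑ l, M k l • (η k * η l) = 0)
    (hN0 : ∑ k, ∑ l, N k l • (η k * η l) = 0) :
    ∃ s t : ℂ, (s ≠ 0 ∨ t ≠ 0) ∧ s • M + t • N = 0 := by
  obtain ⟨s, t, v, hst, hv, hker⟩ := exists_pencil_kernel rfl M.mulVecLin N.mulVecLin
  refine ⟨s, t, hst, ?_⟩
  set T := s • M + t • N with hT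
  have hT0 : ∑ k, ∑ l, T k l • (η k * η l) = 0 := by
    have : ∀ k l, T k l • (η k * η l) = s • (M k l • (η k * η l)) + t • (N k l • (η k * η l)) :=
      fun k l => by simp only [hT, Matrix.add_apply, Matrix.smul_apply, smul_eq_mul]; module
    simp only [this, Finset.sum_add_distrib, ← Finset.smul_sum, hM0, hN0, smul_zero, add_zero]
  refine eq_zero_of_mulVec_eq_zero_of_ternary_relation hη ((hM.smul s).add (hN.smul t)) hT0 hv ?_
  rw [Matrix.add_mulVec, Matrix.smul_mulVec, Matrix.smul_mulVec]
  exact hker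

theorem not_semistableWrt {Λ : Submodule ℂ Quin} {ρ : Fin 5 → ℤ} {F : Fin 3 → Quin}
    (hmem : ∀ i, F i ∈ Λ) (hli : LinearIndependent ℂ F) {w : Fin 3 → ℤ} (hw : ∑ i, w i < 0)
    (hF : ∀ i m, coeff m (F i) ≠ 0 → wt ρ m ≤ w i) : ¬ SemistableWrt Λ ρ := by
  rintro ⟨m1, m2, m3, -, -, -, -, -, -, hwt, hbij⟩
  let m : Fin 3 → Fin 5 →₀ ℕ := ![m1, m2, m3]
  let M : Matrix (Fin 3) (Fin 3) ℂ := Matrix.of fun i j => coeff (m j) (F i)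
  have hdet : M.det ≠ 0 := fun h0 => by
    obtain ⟨c, hc, hcM⟩ := Matrix.exists_vecMul_eq_zero_iff.2 h0
    have hsum : ∑ i, c i • F i = 0 := by
      have : (⟨∑ i, c i • F i, sum_mem fun i _ => Λ.smul_mem _ (hmem i)⟩ : Λ) = 0 := by
        refine hbij.1 ?_
        have h2 : ∀ j, coeff (m j) (∑ i, c i • F i) = 0 := fun j => by
          have := congrFun hcM j
          simpa [Matrix.vecMul, dotProduct, M, coeff_sum] using this
        ext j
        fin_cases j
        · simpa using show coeff m1 (∑ i, c i • F i) = 0 from h2 0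
        · simpa using show coeff m2 (∑ i, c i • F i) = 0 from h2 1
        · simpa using show coeff m3 (∑ i, c i • F i) = 0 from h2 2
      exact congrArg Subtype.val this
    exact hc (funext (Fintype.linearIndependent_iff.1 hli c hsum))
  rw [Matrix.det_apply] at hdet
  obtain ⟨σ, -, hσ⟩ := Finset.exists_ne_zero_of_sum_ne_zero hdet
  have hσ' : ∏ i, M (σ i) i ≠ 0 := fun h => hσ (by rw [h, smul_zero])
  rw [Finset.prod_ne_zero_iff] at hσ'
  have h1 : ∑ i, wt ρ (m i) ≤ ∑ i, w (σ i) :=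
    Finset.sum_le_sum fun i hi => hF _ _ (hσ' i hi)
  rw [Equiv.sum_comp σ w, Fin.sum_univ_three] at h1
  have h2 : wt ρ m1 + wt ρ m2 + wt ρ m3 ≤ ∑ i, w i := h1
  omega

theorem wt_le_of_coeff_quadForm_ne_zero {S : Matrix (Fin 5) (Fin 5) ℂ} {ρ : Fin 5 → ℤ} {w : ℤ}
    (hS : ∀ k l, S k l ≠ 0 → ρ k + ρ l ≤ w) {m : Fin 5 →₀ ℕ} (hm : coeff m (quadForm S) ≠ 0) :
    wt ρ m ≤ w := by
  rw [quadForm_eq_sum, coeff_sum] at hm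
  obtain ⟨k, -, hk⟩ := Finset.exists_ne_zero_of_sum_ne_zero hm
  rw [coeff_sum] at hk
  obtain ⟨l, -, hl⟩ := Finset.exists_ne_zero_of_sum_ne_zero hk
  rw [coeff_smul, X, X, monomial_mul, coeff_monomial] at hl
  split_ifs at hl with h
  · rw [← h]
    refine le_trans (le_of_eq ?_) (hS k l (left_ne_zero_of_mul hl))
    simp [wt, Finsupp.single_apply, add_mul, Finset.sum_add_distrib]
  · simp at hl

theorem substMap_apply (g : Matrix (Fin 5) (Fin 5) ℂ) (F : Quin) :
    substMap g F = aeval (fun i => linForm (g i)) F := by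
  simp only [substMap, linForm_apply, smul_eq_C_mul, AlgHom.toLinearMap_apply]

theorem substMap_substMap (g h : Matrix (Fin 5) (Fin 5) ℂ) (F : Quin) :
    substMap g (substMap h F) = substMap (h * g) F := by
  have : (aeval (fun i => linForm (g i))).comp (aeval fun i => linForm (h i)) =
      aeval (fun i => linForm ((h * g) i)) := by
    refine algHom_ext fun i => ?_
    rw [AlgHom.comp_apply, aeval_X, aeval_X, linForm_apply, map_sum]
    simp only [map_smul, aeval_X]
    simp only [← map_smul, ← map_sum]
    congr 1
  simp only [substMap_apply]
  exact DFunLike.congr_fun this F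

theorem substMap_one (F : Quin) : substMap 1 F = F := by
  have : aeval (fun i => linForm ((1 : Matrix (Fin 5) (Fin 5) ℂ) i)) = AlgHom.id ℂ Quin := by
    refine algHom_ext fun i => ?_
    simp [linForm_apply, Matrix.one_apply]
  rw [substMap_apply, this, AlgHom.id_apply]

theorem substMap_bijective {g h : Matrix (Fin 5) (Fin 5) ℂ} (hgh : g * h = 1) (hhg : h * g = 1) :
    Function.Bijective (substMap g) :=
  Function.bijective_iff_has_inverse.2 ⟨substMap h,
    fun F => by rw [substMap_substMap, hgh, substMap_one],
    fun F => by rw [substMap_substMap, hhg, substMap_one]⟩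

theorem substMap_quadForm (g S : Matrix (Fin 5) (Fin 5) ℂ) :
    substMap g (quadForm S) = quadForm (g.transpose * S * g) := by
  rw [substMap_apply, aeval_linForm_quadForm]

theorem Semistable.map_substMap {Λ : Submodule ℂ Quin} (h : Semistable Λ)
    (g : Matrix.GeneralLinearGroup (Fin 5) ℂ) : Semistable (Λ.map (substMap g.1)) := by
  intro g' ρ hρ
  have hcomp : substMap (g * g').1 = (substMap g'.1).comp (substMap g.1) :=
    LinearMap.ext fun F => (substMap_substMap _ _ F).symm
  have := h (g * g') ρ hρ
  rwa [hcomp, Submodule.map_comp] at this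

theorem not_semistable_of_matrix {Λ : Submodule ℂ Quin} {S : Fin 3 → Matrix (Fin 5) (Fin 5) ℂ}
    (hmem : ∀ i, quadForm (S i) ∈ Λ) (hli : LinearIndependent ℂ fun i => quadForm (S i))
    {g h : Matrix (Fin 5) (Fin 5) ℂ} (hgh : g * h = 1) (hhg : h * g = 1) {ρ : Fin 5 → ℤ}
    (hρ : IsNormalized ρ) {w : Fin 3 → ℤ} (hw : ∑ i, w i < 0)
    (hS : ∀ i k l, (g.transpose * S i * g) k l ≠ 0 → ρ k + ρ l ≤ w i) : ¬ Semistable Λ := by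
  intro hss
  refine not_semistableWrt (F := fun i => substMap g (quadForm (S i)))
    (fun i => Submodule.mem_map_of_mem (hmem i))
    (hli.map' (substMap g) (LinearMap.ker_eq_bot.2 (substMap_bijective hgh hhg).1)) hw
    (fun i m hm => ?_) (hss ⟨g, h, hgh, hhg⟩ ρ hρ)
  rw [substMap_quadForm] at hm
  exact wt_le_of_coeff_quadForm_ne_zero (hS i) hm

theorem LinearIndependent.triple_pencil {V : Type*} [AddCommGroup V] [Module ℂ V] {x y z : V}
    (h : LinearIndependent ℂ ![x, y, z]) {s t : ℂ} (hst : s ≠ 0 ∨ t ≠ 0) :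
    LinearIndependent ℂ ![s • x + t • y, x, z] ∨ LinearIndependent ℂ ![s • x + t • y, y, z] := by
  have key : ∀ a b c : ℂ, a • x + b • y + c • z = 0 → a = 0 ∧ b = 0 ∧ c = 0 := fun a b c e => by
    have := Fintype.linearIndependent_iff.1 h ![a, b, c] (by simpa [Fin.sum_univ_three] using e)
    exact ⟨this 0, this 1, this 2⟩
  rcases hst with hs | ht
  · right
    refine Fintype.linearIndependent_iff.2 fun g hg => ?_
    simp only [Fin.sum_univ_three, Matrix.cons_val] at hg
    obtain ⟨h0, h1, h2⟩ := key (g 0 * s) (g 0 * t + g 1) (g 2) (by rw [← hg]; module)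
    have h0 : g 0 = 0 := (mul_eq_zero.1 h0).resolve_right hs
    intro i
    fin_cases i
    · exact h0
    · simpa [h0] using h1
    · exact h2
  · left
    refine Fintype.linearIndependent_iff.2 fun g hg => ?_
    simp only [Fin.sum_univ_three, Matrix.cons_val] at hg
    obtain ⟨h0, h1, h2⟩ := key (g 0 * s + g 1) (g 0 * t) (g 2) (by rw [← hg]; module)
    have h1 : g 0 = 0 := (mul_eq_zero.1 h1).resolve_right ht
    intro i
    fin_cases i
    · exact h1
    · simpa [h1] using h0
    · exact h2

section

variable {Λ : Submodule ℂ Quin} {A B S : Matrix (Fin 5) (Fin 5) ℂ}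
  (hAΛ : quadForm A ∈ Λ) (hBΛ : quadForm B ∈ Λ) (hSΛ : quadForm S ∈ Λ) (hS : S.IsSymm)
  (hli : LinearIndependent ℂ ![quadForm A, quadForm B, quadForm S])
  {p : Ideal Quin} (hSp : ∀ i, linForm (S i) ∈ p)
include hAΛ hBΛ hSΛ hS hli hSp

theorem not_semistable_of_finrank_linPart_eq_one (hp : Module.finrank ℂ (linPart p) = 1) :
    ¬ Semistable Λ := by
  obtain ⟨g, h, hgh, hhg, h0, -⟩ := exists_matrix_of_finrank_linPart (m := 4) (l := 1) hp
  refine not_semistable_of_matrix (S := ![A, B, S]) (ρ := ![1, 1, 1, 1, -4]) (w := ![2, 2, -8])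
    ?_ ?_ hgh hhg ?_ (by decide) ?_
  · intro i
    fin_cases i
    exacts [hAΛ, hBΛ, hSΛ]
  · convert hli using 1
    ext1 i
    fin_cases i <;> rfl
  · refine ⟨by decide, by decide, by decide⟩
  · intro i k l hkl
    fin_cases i
    · clear hkl; revert k l; decide
    · clear hkl; revert k l; decide
    · have := mt (h0 S hS hSp k l) hkl
      clear hkl
      revert k l
      decide

variable [p.IsPrime] (hA : A.IsSymm) (hB : B.IsSymm) (hAp : quadForm A ∈ p) (hBp : quadForm B ∈ p)
include hA hB hAp hBp

theorem not_semistable_of_finrank_linPart_eq_two (hp : Module.finrank ℂ (linPart p) = 2) :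
    ¬ Semistable Λ := by
  obtain ⟨g, h, hgh, hhg, h0, η, hη, hη0⟩ :=
    exists_matrix_of_finrank_linPart (m := 3) (l := 2) hp
  have hsymm : ∀ T : Matrix (Fin 5) (Fin 5) ℂ, T.IsSymm →
      ((g.transpose * T * g).submatrix (Fin.castAdd 2) (Fin.castAdd 2)).IsSymm := fun T hT => by
    refine Matrix.IsSymm.submatrix ?_ _
    rw [Matrix.IsSymm, Matrix.transpose_mul, Matrix.transpose_mul, Matrix.transpose_transpose, hT,
      Matrix.mul_assoc]
  obtain ⟨s, t, hst, h1⟩ := exists_pencil_eq_zero hη (hsymm A hA) (hsymm B hB)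
    (hη0 A hAp) (hη0 B hBp)
  have h1 : ∀ k l : Fin 5, k.1 < 3 ∧ l.1 < 3 →
      (g.transpose * (s • A + t • B) * g) k l = 0 := by
    rintro k l ⟨hk, hl⟩
    have := congrFun (congrFun h1 ⟨k, hk⟩) ⟨l, hl⟩
    rw [mul_add, add_mul, mul_smul_comm, mul_smul_comm, smul_mul_assoc, smul_mul_assoc]
    exact this
  have key : ∀ T : Matrix (Fin 5) (Fin 5) ℂ, quadForm T ∈ Λ →
      LinearIndependent ℂ ![s • quadForm A + t • quadForm B, quadForm T, quadForm S] →
      ¬ Semistable Λ := by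
    intro T hT hl
    refine not_semistable_of_matrix (S := ![s • A + t • B, T, S]) (ρ := ![2, 2, 2, -3, -3])
      (w := ![-1, 4, -6]) ?_ ?_ hgh hhg ?_ (by decide) ?_
    · intro i
      fin_cases i
      · simpa [quadForm_add, quadForm_smul] using
          Λ.add_mem (Λ.smul_mem s hAΛ) (Λ.smul_mem t hBΛ)
      exacts [hT, hSΛ]
    · convert hl using 1
      ext1 i
      fin_cases i
      · simp [quadForm_add, quadForm_smul]
      all_goals rfl
    · refine ⟨by decide, by decide, by decide⟩
    · intro i k l hkl
      fin_cases i
      · have := mt (h1 k l) hkl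
        clear hkl
        revert k l
        decide
      · clear hkl; revert k l; decide
      · have := mt (h0 S hS hSp k l) hkl
        clear hkl
        revert k l
        decide
  exact (hli.triple_pencil hst).elim (key A hAΛ) (key B hBΛ)

theorem not_semistable_of_finrank_linPart_eq_three (hp : Module.finrank ℂ (linPart p) = 3) :
    ¬ Semistable Λ := by
  obtain ⟨g, h, hgh, hhg, h0, η, hη, hη0⟩ :=
    exists_matrix_of_finrank_linPart (m := 2) (l := 3) hp
  have h1 : ∀ T : Matrix (Fin 5) (Fin 5) ℂ, T.IsSymm → quadForm T ∈ p →
      ∀ k l : Fin 5, k.1 < 2 ∧ l.1 < 2 → (g.transpose * T * g) k l = 0 := by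
    intro T hT hTp
    have hs : (g.transpose * T * g).IsSymm := by
      rw [Matrix.IsSymm, Matrix.transpose_mul, Matrix.transpose_mul, Matrix.transpose_transpose,
        hT, Matrix.mul_assoc]
    have hrel := hη0 T hTp
    simp only [Fin.sum_univ_two] at hrel
    have h10 := hs.apply (Fin.castAdd 3 0) (Fin.castAdd 3 1)
    obtain ⟨h00, h01, h11⟩ := eq_zero_of_binary_relation (y := η 0) (z := η 1)
      (a := (g.transpose * T * g) (Fin.castAdd 3 0) (Fin.castAdd 3 0))
      (b := (g.transpose * T * g) (Fin.castAdd 3 0) (Fin.castAdd 3 1))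
      (c := (g.transpose * T * g) (Fin.castAdd 3 1) (Fin.castAdd 3 1))
      (fun s t hst => by
        have := hη ![s, t] (by simpa using hst)
        exact ⟨congrFun this 0, congrFun this 1⟩)
      (by
        rw [h10, mul_comm (η 1)] at hrel
        rw [← hrel]
        module)
    rintro k l ⟨hk, hl⟩
    obtain ⟨k, hk5⟩ := k
    obtain ⟨l, hl5⟩ := l
    simp only at hk hl
    interval_cases k <;> interval_cases l
    exacts [h00, h01, h10.trans h01, h11]
  refine not_semistable_of_matrix (S := ![A, B, S]) (ρ := ![3, 3, -2, -2, -2]) (w := ![1, 1, -4])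
    ?_ ?_ hgh hhg ?_ (by decide) ?_
  · intro i
    fin_cases i
    exacts [hAΛ, hBΛ, hSΛ]
  · convert hli using 1
    ext1 i
    fin_cases i <;> rfl
  · refine ⟨by decide, by decide, by decide⟩
  · intro i k l hkl
    fin_cases i
    · have := mt (h1 A hA hAp k l) hkl
      clear hkl
      revert k l
      decide
    · have := mt (h1 B hB hBp k l) hkl
      clear hkl
      revert k l
      decide
    · have := mt (h0 S hS hSp k l) hkl
      clear hkl
      revert k l
      decide

theorem not_semistable_of_prime (hp : Module.finrank ℂ (linPart p) ≤ 3) : ¬ Semistable Λ := by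
  obtain h | h | h | h : Module.finrank ℂ (linPart p) = 0 ∨ Module.finrank ℂ (linPart p) = 1 ∨
      Module.finrank ℂ (linPart p) = 2 ∨ Module.finrank ℂ (linPart p) = 3 := by omega
  · have hz : S = 0 := funext fun i => by
      have : S i ∈ linPart p := hSp i
      rwa [Submodule.finrank_eq_zero.1 h, Submodule.mem_bot] at this
    refine absurd ?_ (hli.ne_zero 2)
    simp [hz, quadForm_eq_sum]
  · exact not_semistable_of_finrank_linPart_eq_one hAΛ hBΛ hSΛ hS hli hSp h
  · exact not_semistable_of_finrank_linPart_eq_two hAΛ hBΛ hSΛ hS hli hSp hA hB hAp hBp h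
  · exact not_semistable_of_finrank_linPart_eq_three hAΛ hBΛ hSΛ hS hli hSp hA hB hAp hBp h

end

theorem pderiv_pderiv_comm {σ : Type*} (i j : σ) (F : MvPolynomial σ ℂ) :
    pderiv i (pderiv j F) = pderiv j (pderiv i F) := by
  classical
  have h : ⁅pderiv (R := ℂ) i, pderiv (R := ℂ) j⁆ = 0 := by
    refine derivation_ext fun k => ?_
    simp only [Derivation.commutator_apply, pderiv_X, Pi.single_apply]
    split_ifs <;> simp
  rw [← sub_eq_zero, ← Derivation.commutator_apply, h, Derivation.zero_apply]

theorem exists_quadForm_eq {n : ℕ} {F : MvPolynomial (Fin n) ℂ} (hF : F.IsHomogeneous 2) :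
    ∃ A : Matrix (Fin n) (Fin n) ℂ, A.IsSymm ∧ quadForm A = F := by
  have hC : ∀ i j, pderiv j (pderiv i F) = C (coeff 0 (pderiv j (pderiv i F))) := fun i j =>
    totalDegree_eq_zero_iff_eq_C.1 (Nat.le_zero.1 (hF.pderiv.pderiv.totalDegree_le))
  have h1 : ∀ i, linForm (fun j => coeff 0 (pderiv j (pderiv i F))) = pderiv i F := fun i => by
    have := (hF.pderiv (i := i)).sum_X_mul_pderiv
    rw [show 2 - 1 = 1 from rfl, one_smul] at this
    refine Eq.trans ?_ this
    rw [linForm_apply]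
    refine Finset.sum_congr rfl fun j _ => ?_
    rw [smul_eq_C_mul, ← hC, mul_comm]
  have h2 : quadForm (Matrix.of fun i j => coeff 0 (pderiv j (pderiv i F))) = (2 : ℂ) • F := by
    have := hF.sum_X_mul_pderiv
    rw [two_smul, ← two_smul ℂ] at this
    rw [← this]
    exact Finset.sum_congr rfl fun i _ => congrArg _ (h1 i)
  refine ⟨(2 : ℂ)⁻¹ • Matrix.of fun i j => coeff 0 (pderiv j (pderiv i F)), ?_, ?_⟩
  · refine Matrix.IsSymm.smul (Matrix.IsSymm.ext fun i j => ?_) _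
    simp only [Matrix.of_apply]
    rw [pderiv_pderiv_comm]
  · rw [quadForm_smul, h2, smul_smul, inv_mul_cancel₀ two_ne_zero, one_smul]

theorem eval_linForm {n : ℕ} (v w : Fin n → ℂ) : eval v (linForm w) = w ⬝ᵥ v := by
  simp [linForm_apply, dotProduct]

theorem eval_quadForm {n : ℕ} (A : Matrix (Fin n) (Fin n) ℂ) (v : Fin n → ℂ) :
    eval v (quadForm A) = v ⬝ᵥ A.mulVec v := by
  simp [quadForm, eval_linForm, dotProduct, Matrix.mulVec]

theorem eval_pderiv_quadForm {n : ℕ} {A : Matrix (Fin n) (Fin n) ℂ} (hA : A.IsSymm)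
    (v : Fin n → ℂ) (i : Fin n) : eval v (pderiv i (quadForm A)) = 2 * A.mulVec v i := by
  rw [pderiv_quadForm hA, map_mul, eval_linForm, map_ofNat]
  rfl

/-- At a common zero of the two quadrics the vectors `A v` and `B v` are independent. -/
def RegularPencil (A B : Matrix (Fin 5) (Fin 5) ℂ) : Prop :=
  ∀ v ≠ 0, v ⬝ᵥ A.mulVec v = 0 → v ⬝ᵥ B.mulVec v = 0 →
    ∀ s t : ℂ, s • A.mulVec v + t • B.mulVec v = 0 → s = 0 ∧ t = 0

theorem regularPencil_of_linearIndependent {A B : Matrix (Fin 5) (Fin 5) ℂ} (hA : A.IsSymm)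
    (hB : B.IsSymm)
    (h : ∀ v : Fin 5 → ℂ, v ≠ 0 → eval v (quadForm A) = 0 → eval v (quadForm B) = 0 →
      LinearIndependent ℂ ![fun i => eval v (pderiv i (quadForm A)),
          fun i => eval v (pderiv i (quadForm B))]) : RegularPencil A B := by
  intro v hv hAv hBv s t hst
  refine LinearIndependent.pair_iff.1 (h v hv (by rw [eval_quadForm, hAv])
    (by rw [eval_quadForm, hBv])) s t (funext fun i => ?_)
  have := congrFun hst i
  simp only [Pi.add_apply, Pi.smul_apply, smul_eq_mul, Pi.zero_apply, eval_pderiv_quadForm hA,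
    eval_pderiv_quadForm hB] at this ⊢
  linear_combination 2 * this

theorem RegularPencil.congr {A B g h : Matrix (Fin 5) (Fin 5) ℂ} (H : RegularPencil A B)
    (hgh : g * h = 1) (hhg : h * g = 1) :
    RegularPencil (g.transpose * A * g) (g.transpose * B * g) := by
  have key : ∀ (M : Matrix (Fin 5) (Fin 5) ℂ) v,
      (g.transpose * M * g).mulVec v = g.transpose.mulVec (M.mulVec (g.mulVec v)) := fun M v => by
    rw [Matrix.mulVec_mulVec, Matrix.mulVec_mulVec, mul_assoc]
  have key2 : ∀ (M : Matrix (Fin 5) (Fin 5) ℂ) v,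
      v ⬝ᵥ (g.transpose * M * g).mulVec v = g.mulVec v ⬝ᵥ M.mulVec (g.mulVec v) := fun M v => by
    rw [key, Matrix.dotProduct_mulVec, Matrix.vecMul_transpose]
  intro v hv hAv hBv s t hst
  rw [key2] at hAv hBv
  refine H _ (fun h0 => hv ?_) hAv hBv s t ?_
  · have := congrArg h.mulVec h0
    rwa [Matrix.mulVec_mulVec, hhg, Matrix.one_mulVec, Matrix.mulVec_zero] at this
  · have := congrArg h.transpose.mulVec hst
    rwa [key, key, ← Matrix.mulVec_smul g.transpose, ← Matrix.mulVec_smul g.transpose,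
      ← Matrix.mulVec_add, Matrix.mulVec_mulVec, ← Matrix.transpose_mul, hgh, Matrix.transpose_one, Matrix.one_mulVec,
      Matrix.mulVec_zero] at this

theorem RegularPencil.exists_diagonal {A B : Matrix (Fin 5) (Fin 5) ℂ} (H : RegularPencil A B)
    (hA : A.IsSymm) (hB : B.IsSymm) : ∃ g h : Matrix (Fin 5) (Fin 5) ℂ, g * h = 1 ∧ h * g = 1 ∧
      ∃ a b : Fin 5 → ℂ, g.transpose * A * g = Matrix.diagonal a ∧
        g.transpose * B * g = Matrix.diagonal b := by
  have hsymm : ∀ M : Matrix (Fin 5) (Fin 5) ℂ, M.IsSymm → ∀ v w,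
      Matrix.toBilin' M v w = Matrix.toBilin' M w v := fun M hM v w => by
    rw [Matrix.toBilin'_apply', Matrix.toBilin'_apply', Matrix.dotProduct_mulVec,
      ← Matrix.mulVec_transpose, hM, dotProduct_comm]
  obtain ⟨b, hb⟩ := exists_basis_diagonalizing 5 (V := Fin 5 → ℂ) (by simp) (Matrix.toBilin' A)
    (Matrix.toBilin' B) (hsymm A hA) (hsymm B hB) (fun v hv hAv hBv s t hst => by
      rw [Matrix.toBilin'_apply'] at hAv hBv
      refine H v hv hAv hBv s t (funext fun i => ?_)
      have := LinearMap.congr_fun hst (Pi.single i 1)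
      rw [LinearMap.add_apply, LinearMap.smul_apply, LinearMap.smul_apply, hsymm A hA,
        hsymm B hB, Matrix.toBilin'_apply', Matrix.toBilin'_apply', single_one_dotProduct,
        single_one_dotProduct] at this
      exact this)
  have hdiag : ∀ M : Matrix (Fin 5) (Fin 5) ℂ,
      (∀ i j, i ≠ j → Matrix.toBilin' M (b i) (b j) = 0) →
      ((Pi.basisFun ℂ (Fin 5)).toMatrix b).transpose * M * (Pi.basisFun ℂ (Fin 5)).toMatrix b =
        Matrix.diagonal fun i => Matrix.toBilin' M (b i) (b i) := by
    intro M hM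
    have : ((Pi.basisFun ℂ (Fin 5)).toMatrix b).transpose * M * (Pi.basisFun ℂ (Fin 5)).toMatrix b =
        Matrix.of fun i j => Matrix.toBilin' M (b i) (b j) := by
      ext i j
      rw [Matrix.of_apply, Matrix.toBilin'_apply', Matrix.mul_assoc, Matrix.mul_apply]
      rfl
    rw [this]
    ext i j
    rw [Matrix.of_apply, Matrix.diagonal_apply]
    split_ifs with h
    · rw [h]
    · exact hM i j h
  exact ⟨(Pi.basisFun ℂ (Fin 5)).toMatrix b, b.toMatrix (Pi.basisFun ℂ (Fin 5)),
    Module.Basis.toMatrix_mul_toMatrix_flip _ _, Module.Basis.toMatrix_mul_toMatrix_flip _ _,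
    _, _, hdiag A fun i j h => (hb i j h).1, hdiag B fun i j h => (hb i j h).2⟩

theorem exists_kernel_of_det_eq_zero {p q r s : ℂ} (h : p * s - q * r = 0) :
    ∃ x y : ℂ, (x ≠ 0 ∨ y ≠ 0) ∧ p * x + q * y = 0 ∧ r * x + s * y = 0 := by
  by_cases hpq : p = 0 ∧ q = 0
  · by_cases hrs : r = 0 ∧ s = 0
    · exact ⟨1, 0, Or.inl one_ne_zero, by simp [hpq], by simp [hrs]⟩
    · refine ⟨s, -r, ?_, by simp [hpq], by ring⟩
      rw [neg_ne_zero]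
      tauto
  · refine ⟨q, -p, ?_, by ring, by linear_combination -h⟩
    rw [neg_ne_zero]
    tauto

theorem RegularPencil.diagonal_minor_ne_zero {a b : Fin 5 → ℂ}
    (H : RegularPencil (Matrix.diagonal a) (Matrix.diagonal b)) {i j : Fin 5} (hij : i ≠ j) :
    a i * b j - a j * b i ≠ 0 := by
  intro h0
  obtain ⟨x, x', hx, e1, e2⟩ := exists_kernel_of_det_eq_zero h0
  obtain ⟨c, c', hc, e3, e4⟩ := exists_kernel_of_det_eq_zero
    (show a i * b j - b i * a j = 0 by linear_combination h0)
  obtain ⟨y, hy⟩ := IsAlgClosed.exists_pow_nat_eq x two_pos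
  obtain ⟨z, hz⟩ := IsAlgClosed.exists_pow_nat_eq x' two_pos
  have hd : ∀ u : Fin 5 → ℂ, (Matrix.diagonal u).mulVec (Pi.single i y + Pi.single j z) =
      Pi.single i (u i * y) + Pi.single j (u j * z) := fun u => by
    rw [Matrix.mulVec_add, Matrix.diagonal_mulVec_single, Matrix.diagonal_mulVec_single]
  have hd2 : ∀ u : Fin 5 → ℂ, (Pi.single i y + Pi.single j z : Fin 5 → ℂ) ⬝ᵥ
      (Matrix.diagonal u).mulVec (Pi.single i y + Pi.single j z) = u i * x + u j * x' := fun u => by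
    rw [hd, add_dotProduct, single_dotProduct, single_dotProduct, ← hy, ← hz]
    simp only [Pi.add_apply, Pi.single_eq_same, Pi.single_eq_of_ne hij, Pi.single_eq_of_ne hij.symm]
    ring
  have hv : (Pi.single i y + Pi.single j z : Fin 5 → ℂ) ≠ 0 := fun hv => by
    have hvi := congrFun hv i
    have hvj := congrFun hv j
    simp only [Pi.add_apply, Pi.single_eq_same, Pi.single_eq_of_ne hij,
      Pi.single_eq_of_ne hij.symm, Pi.zero_apply, add_zero, zero_add] at hvi hvj
    simp [← hy, ← hz, hvi, hvj] at hx
  have hcc := H _ hv ((hd2 a).trans e1) ((hd2 b).trans e2) c c' (by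
    have e5 : c • (a i * y) + c' • (b i * y) = 0 := by
      simp only [smul_eq_mul]; linear_combination y * e3
    have e6 : c • (a j * z) + c' • (b j * z) = 0 := by
      simp only [smul_eq_mul]; linear_combination z * e4
    rw [hd, hd, smul_add, smul_add, ← Pi.single_smul, ← Pi.single_smul, ← Pi.single_smul,
      ← Pi.single_smul, add_add_add_comm, ← Pi.single_add, ← Pi.single_add, e5, e6,
      Pi.single_zero, Pi.single_zero, add_zero])
  tauto

theorem isRadical_of_regularPencil {Λ : Submodule ℂ Quin} (hss : Semistable Λ)
    {A B S : Matrix (Fin 5) (Fin 5) ℂ} (hA : A.IsSymm) (hB : B.IsSymm) (hS : S.IsSymm)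
    (hAΛ : quadForm A ∈ Λ) (hBΛ : quadForm B ∈ Λ) (hSΛ : quadForm S ∈ Λ)
    (hli : LinearIndependent ℂ ![quadForm A, quadForm B, quadForm S])
    (H : RegularPencil A B) :
    (Ideal.span {quadForm A, quadForm B, quadForm S}).IsRadical := by
  obtain ⟨g, h, hgh, hhg, a, b, ha, hb⟩ := H.exists_diagonal hA hB
  have hab : ∀ i j, i ≠ j → a i * b j - a j * b i ≠ 0 := fun i j hij => by
    have := H.congr hgh hhg
    rw [ha, hb] at this
    exact this.diagonal_minor_ne_zero hij
  have hbij := substMap_bijective hgh hhg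
  have hS' : (g.transpose * S * g).IsSymm := by
    rw [Matrix.IsSymm, Matrix.transpose_mul, Matrix.transpose_mul, Matrix.transpose_transpose,
      hS, Matrix.mul_assoc]
  have hgA : substMap g (quadForm A) = diagForm a := by
    rw [substMap_quadForm, ha, quadForm_diagonal]
  have hgB : substMap g (quadForm B) = diagForm b := by
    rw [substMap_quadForm, hb, quadForm_diagonal]
  suffices hrad : (Ideal.span {diagForm a, diagForm b,
      quadForm (g.transpose * S * g)}).IsRadical by
    let σ : Quin →ₐ[ℂ] Quin := aeval fun i => ∑ j, C (g i j) * X j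
    have hmap : (Ideal.span {quadForm A, quadForm B, quadForm S}).map σ =
        Ideal.span {diagForm a, diagForm b, quadForm (g.transpose * S * g)} := by
      rw [Ideal.map_span, Set.image_insert_eq, Set.image_pair, ← hgA, ← hgB, ← substMap_quadForm]
      rfl
    rw [← Ideal.comap_map_of_bijective σ hbij (I := Ideal.span {quadForm A, quadForm B, quadForm S}),
      hmap]
    exact hrad.comap σ
  by_contra hr
  obtain ⟨p, hp, hap, hbp, hrank, α, β, hαβ⟩ := exists_linForm_mem_of_not_isRadical hab hS' hr
  have hsym : (g.transpose * S * g - (α • Matrix.diagonal a + β • Matrix.diagonal b)).IsSymm :=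
    hS'.sub (((Matrix.isSymm_diagonal a).smul α).add ((Matrix.isSymm_diagonal b).smul β))
  have hq : quadForm (g.transpose * S * g - (α • Matrix.diagonal a + β • Matrix.diagonal b)) =
      quadForm (g.transpose * S * g) - (α • diagForm a + β • diagForm b) := by
    rw [eq_sub_iff_add_eq, ← quadForm_diagonal, ← quadForm_diagonal, ← quadForm_smul,
      ← quadForm_smul, ← quadForm_add, ← quadForm_add, sub_add_cancel]
  have haΛ : diagForm a ∈ Λ.map (substMap g) := hgA ▸ Submodule.mem_map_of_mem hAΛ
  have hbΛ : diagForm b ∈ Λ.map (substMap g) := hgB ▸ Submodule.mem_map_of_mem hBΛ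
  have hqΛ : quadForm (g.transpose * S * g) ∈ Λ.map (substMap g) :=
    substMap_quadForm g S ▸ Submodule.mem_map_of_mem hSΛ
  refine not_semistable_of_prime (Λ := Λ.map (substMap g)) (A := Matrix.diagonal a)
    (B := Matrix.diagonal b) (p := p) ?_ ?_ ?_ hsym ?_ ?_ (Matrix.isSymm_diagonal a)
    (Matrix.isSymm_diagonal b) ?_ ?_ hrank (hss.map_substMap ⟨g, h, hgh, hhg⟩)
  · rwa [quadForm_diagonal]
  · rwa [quadForm_diagonal]
  · rw [hq]
    exact sub_mem hqΛ (add_mem (Submodule.smul_mem _ _ haΛ) (Submodule.smul_mem _ _ hbΛ))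
  · have hl := hli.map' (substMap g) (LinearMap.ker_eq_bot.2 hbij.1)
    rw [Fintype.linearIndependent_iff] at hl ⊢
    intro c hc
    have := hl ![c 0 - c 2 * α, c 1 - c 2 * β, c 2] (by
      simp only [Fin.sum_univ_three, Function.comp_apply, Matrix.cons_val, hgA, hgB,
        substMap_quadForm g S, quadForm_diagonal, hq] at hc ⊢
      rw [← hc]
      module)
    have h0 := this 0
    have h1 := this 1
    have h2 : c 2 = 0 := this 2
    simp only [Matrix.cons_val, h2, zero_mul, sub_zero] at h0 h1
    intro i
    fin_cases i
    exacts [h0, h1, h2]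
  · intro i
    convert hαβ i using 1
    have : (g.transpose * S * g - (α • Matrix.diagonal a + β • Matrix.diagonal b)) i =
        (g.transpose * S * g) i - Pi.single i (a i * α + b i * β) := by
      ext j
      by_cases hij : i = j
      · subst hij
        simp [mul_comm]
      · simp [hij, Matrix.diagonal_apply_ne]
    rw [this, map_sub, linForm_apply (Pi.single _ _)]
    simp [Pi.single_apply, smul_eq_C_mul]
  · rwa [quadForm_diagonal]
  · rwa [quadForm_diagonal]

theorem exists_linearIndependent_triple {K V : Type*} [DivisionRing K] [AddCommGroup V] [Module K V]
    {N : Submodule K V} (hN : Module.finrank K N = 3) {x y : V} (hx : x ∈ N) (hy : y ∈ N)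
    (hxy : LinearIndependent K ![x, y]) :
    ∃ z ∈ N, LinearIndependent K ![x, y, z] ∧ Submodule.span K {x, y, z} = N := by
  have hli : LinearIndependent K (![⟨x, hx⟩, ⟨y, hy⟩] : Fin 2 → N) := by
    refine LinearIndependent.of_comp N.subtype ?_
    convert hxy using 1
    ext i
    fin_cases i <;> rfl
  obtain ⟨z, hz⟩ := exists_linearIndependent_snoc_of_lt_finrank hli (by omega)
  have hz' : LinearIndependent K ![x, y, (z : V)] := by
    have hz := hz.map' N.subtype N.ker_subtype
    rwa [show N.subtype ∘ Fin.snoc ![⟨x, hx⟩, ⟨y, hy⟩] z = ![x, y, (z : V)] by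
      ext i
      fin_cases i <;> rfl] at hz
  refine ⟨z, z.2, hz', ?_⟩
  have := FiniteDimensional.of_finrank_pos (K := K) (V := N) (by omega)
  refine Submodule.eq_of_le_of_finrank_eq ?_ ?_
  · rw [Submodule.span_le]
    rintro _ (rfl | rfl | rfl)
    exacts [hx, hy, z.2]
  · have hcard := finrank_span_eq_card hz'
    rw [show Set.range ![x, y, (z : V)] = {x, y, (z : V)} by
      ext v
      constructor
      · rintro ⟨i, rfl⟩
        fin_cases i <;> simp
      · rintro (rfl | rfl | rfl)
        exacts [⟨0, rfl⟩, ⟨1, rfl⟩, ⟨2, rfl⟩]] at hcard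
    rw [hN, hcard]
    rfl

/-- A semistable net lying on a smooth quartic del Pezzo surface cuts out
a reduced curve (its ideal is radical). -/
theorem reduced_of_smooth_delPezzo (Λ : Submodule ℂ Quin) (hΛ : IsNet Λ)
    (hss : Semistable Λ)
    (Q1 Q2 Q3 : Quin) (hQ1 : Q1 ∈ Λ) (hQ2 : Q2 ∈ Λ) (hQ3 : Q3 ∈ Λ)
    (hli : LinearIndependent ℂ ![Q1, Q2, Q3])
    (hspan : Submodule.span ℂ {Q1, Q2, Q3} = Λ)
    (hdp : OnSmoothDelPezzo Λ) :
    (Ideal.span {Q1, Q2, Q3} : Ideal Quin).IsRadical := by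
  obtain ⟨P1, P2, hP1, hP2, hP, hsmooth⟩ := hdp
  obtain ⟨P3, hP3, hPli, hPspan⟩ := exists_linearIndependent_triple hΛ.1 hP1 hP2 hP
  obtain ⟨A, hA, rfl⟩ := exists_quadForm_eq (hΛ.2 P1 hP1)
  obtain ⟨B, hB, rfl⟩ := exists_quadForm_eq (hΛ.2 P2 hP2)
  obtain ⟨S, hS, rfl⟩ := exists_quadForm_eq (hΛ.2 P3 hP3)
  have hideal : (Ideal.span {Q1, Q2, Q3} : Ideal Quin) =
      Ideal.span {quadForm A, quadForm B, quadForm S} := by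
    simp only [Ideal.span]
    rw [← Submodule.span_span_of_tower ℂ Quin {Q1, Q2, Q3}, hspan, ← hPspan,
      Submodule.span_span_of_tower]
  rw [hideal]
  exact isRadical_of_regularPencil hss hA hB hS hP1 hP2 hP3 hPli
    (regularPencil_of_linearIndependent hA hB hsmooth)
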